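/- For every m ≥ 1 and any two knot-like complexes C_1 and C_2, the shifted complex sh_m(C_1 ⊗_R C_2) is locally equivalent to sh_m(C_1) ⊗_R sh_m(C_2). Consequently sh_m defines a group endomorphism of the local equivalence group KL. -/

import Mathlib

/-!
Common setup: the ring `R = 𝔽₂[U,V]/(UV = 0)`, bigraded free finitely generated chain
complexes over `R` ("pre-complexes"), knot-like complexes, local maps and local
equivalence, standard and semistandard complexes, short maps, the `Z^!` order,
the invariants `a_i`, `φ_j`, `P`, shift maps, tensor products, duals, and direct sums.
-/

set_option synthInstance.maxHeartbeats 1000000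
set_option maxHeartbeats 1000000

noncomputable section

/-- The polynomial ring `𝔽₂[U,V]`. -/
abbrev PolyUV : Type := MvPolynomial (Fin 2) (ZMod 2)

/-- The ideal `(U·V)`. -/
def IUV : Ideal PolyUV := Ideal.span {(MvPolynomial.X 0 * MvPolynomial.X 1 : PolyUV)}

/-- The ring `R = 𝔽₂[U,V]/(UV = 0)`. -/
abbrev RUV : Type := PolyUV ⧸ IUV

instance : CommRing RUV := Ideal.Quotient.commRing IUV

/-- The image of `U` in `R`. -/
def Uv : RUV := Ideal.Quotient.mk IUV (MvPolynomial.X 0)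

/-- The image of `V` in `R`. -/
def Vv : RUV := Ideal.Quotient.mk IUV (MvPolynomial.X 1)

/-- `r ∈ R` is homogeneous of bidegree `(p, q)` for the bigrading with
`gr(U) = (-2, 0)`, `gr(V) = (0, -2)`, `gr(1) = (0, 0)` (coefficients in `𝔽₂`). -/
def IsHomog (r : RUV) (p q : ℤ) : Prop :=
  r = 0 ∨ (∃ a : ℕ, r = Uv ^ a ∧ p = -(2 * (a : ℤ)) ∧ q = 0) ∨
    (∃ b : ℕ, r = Vv ^ b ∧ p = 0 ∧ q = -(2 * (b : ℤ)))

/-- A finitely generated free bigraded module over `R` with a distinguished basis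
indexed by `Fin n`, together with a bigrading `gr` on the basis and a matrix `dm`
recording a prospective differential: `dm i j` is the coefficient of the `j`-th basis
vector in the differential of the `i`-th basis vector. -/
structure PreCx where
  n : ℕ
  gr : Fin n → ℤ × ℤ
  dm : Fin n → Fin n → RUV

/-- The underlying free `R`-module of a pre-complex. -/
abbrev Msub (C : PreCx) : Type := Fin C.n →₀ RUV

/-- The differential of a pre-complex, as an `R`-linear map. -/
def dmap (C : PreCx) : Msub C →ₗ[RUV] Msub C :=
  Finsupp.linearCombination RUV fun i => ∑ j, Finsupp.single j (C.dm i j)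

/-- The submodule `U·C ⊆ C`; `C/U` is the quotient by this submodule. -/
def uSub (C : PreCx) : Submodule RUV (Msub C) :=
  LinearMap.range (LinearMap.lsmul RUV (Msub C) Uv)

/-- The submodule `V·C ⊆ C`; `C/V` is the quotient by this submodule. -/
def vSub (C : PreCx) : Submodule RUV (Msub C) :=
  LinearMap.range (LinearMap.lsmul RUV (Msub C) Vv)

/-- Chains which die in the homology of `C/U`: the preimage in `C` of the boundaries of
the induced differential on `C/U`. -/
def bdryU (C : PreCx) : Submodule RUV (Msub C) := uSub C ⊔ LinearMap.range (dmap C)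

/-- Chains which die in the homology of `C/V`. -/
def bdryV (C : PreCx) : Submodule RUV (Msub C) := vSub C ⊔ LinearMap.range (dmap C)

/-- A chain `x ∈ C` is homogeneous of bidegree `(p, q)`. -/
def ChainHomog (C : PreCx) (x : Msub C) (p q : ℤ) : Prop :=
  ∀ j, IsHomog (x j) (p - (C.gr j).1) (q - (C.gr j).2)

/-- `x` is a `V`-tower class generator: its class in `H_*(C/U)` is a `V`-nontorsion cycle
whose image generates `H_*(C/U)/(V-torsion)` (equivalently, it is maximally `V`-graded
among `V`-nontorsion classes). -/
def IsVTowerGen (C : PreCx) (x : Msub C) : Prop :=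
  dmap C x ∈ uSub C ∧ (∀ k : ℕ, Vv ^ k • x ∉ bdryU C) ∧
    ∀ z : Msub C, dmap C z ∈ uSub C →
      ∃ (r : RUV) (k : ℕ), Vv ^ k • (z - r • x) ∈ bdryU C

/-- `x` is a `U`-tower class generator: its class in `H_*(C/V)` is a `U`-nontorsion cycle
whose image generates `H_*(C/V)/(U-torsion)`. -/
def IsUTowerGen (C : PreCx) (x : Msub C) : Prop :=
  dmap C x ∈ vSub C ∧ (∀ k : ℕ, Uv ^ k • x ∉ bdryV C) ∧
    ∀ z : Msub C, dmap C z ∈ vSub C →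
      ∃ (r : RUV) (k : ℕ), Uv ^ k • (z - r • x) ∈ bdryV C

/-- `C` is a chain complex over `R` whose differential has degree `(-1, -1)`. -/
def IsCplx (C : PreCx) : Prop :=
  (∀ x, dmap C (dmap C x) = 0) ∧
    ∀ i j, IsHomog (C.dm i j) ((C.gr i).1 - 1 - (C.gr j).1) ((C.gr i).2 - 1 - (C.gr j).2)

/-- A knot-like complex: a free, finitely generated, bigraded chain complex over `R`
whose differential has degree `(-1,-1)`, such that `H_*(C/U)/(V`-torsion`) ≅ 𝔽₂[V]` with
all `V`-nontorsion elements of `H_*(C/U)` in `U`-grading `0`, and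
`H_*(C/V)/(U`-torsion`) ≅ 𝔽₂[U]` with all `U`-nontorsion elements of `H_*(C/V)` in
`V`-grading `0`. -/
structure IsKnotLike (C : PreCx) : Prop where
  dsq : ∀ x, dmap C (dmap C x) = 0
  dhomog : ∀ i j, IsHomog (C.dm i j)
    ((C.gr i).1 - 1 - (C.gr j).1) ((C.gr i).2 - 1 - (C.gr j).2)
  vTowerExists : ∃ x, IsVTowerGen C x
  vTowerGr : ∀ x p q, ChainHomog C x p q → dmap C x ∈ uSub C →
    (∀ k : ℕ, Vv ^ k • x ∉ bdryU C) → p = 0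
  uTowerExists : ∃ x, IsUTowerGen C x
  uTowerGr : ∀ x p q, ChainHomog C x p q → dmap C x ∈ vSub C →
    (∀ k : ℕ, Uv ^ k • x ∉ bdryV C) → q = 0

/-- A module map `f : C₁ → C₂` is homogeneous of bidegree `(s, t)`. -/
def MapHomogShift (C₁ C₂ : PreCx) (f : Msub C₁ →ₗ[RUV] Msub C₂) (s t : ℤ) : Prop :=
  ∀ i j, IsHomog (f (Finsupp.single i 1) j)
    ((C₁.gr i).1 + s - (C₂.gr j).1) ((C₁.gr i).2 + t - (C₂.gr j).2)

/-- A local map `f : C₁ → C₂`: an absolutely `U`-graded, relatively `V`-graded,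
`R`-equivariant chain map inducing an isomorphism on `H_*(·/U)/(V-torsion)`
(equivalently, taking `V`-tower generators to `V`-tower generators). -/
structure IsLocalMap (C₁ C₂ : PreCx) (f : Msub C₁ →ₗ[RUV] Msub C₂) : Prop where
  chain : ∀ x, f (dmap C₁ x) = dmap C₂ (f x)
  graded : ∃ s : ℤ, MapHomogShift C₁ C₂ f 0 s
  towers : ∀ x, IsVTowerGen C₁ x → IsVTowerGen C₂ (f x)

/-- `C₁ ≤ C₂`: there exists a local map `C₁ → C₂`. -/
def LocalLE (C₁ C₂ : PreCx) : Prop := ∃ f, IsLocalMap C₁ C₂ f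

/-- Local equivalence of complexes: local maps in both directions. -/
def LocalEquiv (C₁ C₂ : PreCx) : Prop := LocalLE C₁ C₂ ∧ LocalLE C₂ C₁

/-- `C` is reduced: `∂ ≡ 0 mod (U, V)`. -/
def Reduced (C : PreCx) : Prop := ∀ i j, C.dm i j ∈ Ideal.span ({Uv, Vv} : Set RUV)

/-! ### Standard complexes -/

/-- The shift in bigrading from `x_k` to `x_{k+1}` in a standard complex, where the
parameter joining them is `b` (`k` is the 0-based index of the parameter, so the
parameter is a `U`-power arrow if `k` is even and a `V`-power arrow if `k` is odd). -/
def stepShift (k : ℕ) (b : ℤ) : ℤ × ℤ :=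
  if k % 2 = 0 then
    if b < 0 then (2 * (b.natAbs : ℤ) - 1, -1) else (1 - 2 * (b.natAbs : ℤ), 1)
  else
    if b < 0 then (-1, 2 * (b.natAbs : ℤ) - 1) else (1, 1 - 2 * (b.natAbs : ℤ))

/-- Bigrading of `x_i` relative to `x_0` in the standard complex with parameters `L`. -/
def grRel (L : List ℤ) (i : ℕ) : ℤ × ℤ :=
  ∑ k ∈ Finset.range i, stepShift k (L.getD k 0)

/-- The bigrading of the standard complex of parameters `L`, normalized so that
`gr_U(x_0) = 0` and `gr_V(x_n) = 0`. -/
def stdGr (L : List ℤ) (i : Fin (L.length + 1)) : ℤ × ℤ :=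
  ((grRel L (i : ℕ)).1, (grRel L (i : ℕ)).2 - (grRel L L.length).2)

/-- The differential matrix of the standard complex of parameters `L = (b_1, …, b_n)`:
for `i` odd (1-based), `∂_U x_{i-1} = U^{|b_i|} x_i` if `b_i < 0` and
`∂_U x_i = U^{b_i} x_{i-1}` if `b_i > 0`; for `i` even the same with `V` in place of `U`;
all other differentials vanish. -/
def stdDm (L : List ℤ) (i j : Fin (L.length + 1)) : RUV :=
  if (j : ℕ) = (i : ℕ) + 1 ∧ L.getD (i : ℕ) 0 < 0 then
    (if (i : ℕ) % 2 = 0 then Uv else Vv) ^ (L.getD (i : ℕ) 0).natAbs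
  else if (i : ℕ) = (j : ℕ) + 1 ∧ 0 < L.getD (j : ℕ) 0 then
    (if (j : ℕ) % 2 = 0 then Uv else Vv) ^ (L.getD (j : ℕ) 0).natAbs
  else 0

/-- The standard complex `C(b_1, …, b_n)` of a list of parameters `L = (b_1, …, b_n)`,
with generators `x_0, …, x_n`.  (For `L = []` this is the trivial complex `R`.) -/
def StdCx (L : List ℤ) : PreCx := ⟨L.length + 1, stdGr L, stdDm L⟩

/-- `L` is a valid parameter sequence for a standard complex: all entries are nonzero
and the length is even (possibly zero). -/
def IsStdSeq (L : List ℤ) : Prop := (∀ b ∈ L, b ≠ 0) ∧ Even L.length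

/-- The trivial standard complex `C(0) = R`. -/
def trivCx : PreCx := StdCx []

/-- The bigrading of the semistandard complex `C'(b_1, …, b_n)` (`n` odd), inherited from
the ambient standard complex `C(b_1, …, b_n, 1)`. -/
def semiGr (L : List ℤ) (i : Fin (L.length + 1)) : ℤ × ℤ :=
  ((grRel L (i : ℕ)).1, (grRel L (i : ℕ)).2 - (grRel L L.length).2 + 1)

/-- The semistandard complex `C'(b_1, …, b_n)` (`n` odd): the subcomplex of
`C(b_1, …, b_n, 1)` generated by `x_0, …, x_n`. -/
def SemiStdCx (L : List ℤ) : PreCx := ⟨L.length + 1, semiGr L, stdDm L⟩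

/-! ### Tensor products, duals, direct sums -/

/-- The tensor product (over `R`) of two pre-complexes, with basis `x_i ⊗ y_j` and
differential `∂(x ⊗ y) = ∂x ⊗ y + x ⊗ ∂y` (signs are irrelevant in characteristic 2). -/
def tensorCx (C₁ C₂ : PreCx) : PreCx where
  n := C₁.n * C₂.n
  gr := fun p => C₁.gr (finProdFinEquiv.symm p).1 + C₂.gr (finProdFinEquiv.symm p).2
  dm := fun p q =>
    (if (finProdFinEquiv.symm p).2 = (finProdFinEquiv.symm q).2 then
      C₁.dm (finProdFinEquiv.symm p).1 (finProdFinEquiv.symm q).1 else 0) +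
    (if (finProdFinEquiv.symm p).1 = (finProdFinEquiv.symm q).1 then
      C₂.dm (finProdFinEquiv.symm p).2 (finProdFinEquiv.symm q).2 else 0)

/-- The dual complex `C^∨ = Hom_R(C, R)`, described on the dual basis: the gradings are
negated and the differential matrix is transposed. -/
def dualCx (C : PreCx) : PreCx := ⟨C.n, fun i => -C.gr i, fun i j => C.dm j i⟩

/-- The direct sum of two pre-complexes. -/
def sumCx (C₁ C₂ : PreCx) : PreCx where
  n := C₁.n + C₂.n
  gr := fun p => Sum.elim C₁.gr C₂.gr (finSumFinEquiv.symm p)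
  dm := fun p q =>
    match finSumFinEquiv.symm p, finSumFinEquiv.symm q with
    | Sum.inl i, Sum.inl k => C₁.dm i k
    | Sum.inr j, Sum.inr l => C₂.dm j l
    | _, _ => 0

/-- A homotopy equivalence of bigraded chain complexes over `R`: chain maps `f, g`
preserving the bigrading, with `g ∘ f ≃ id` and `f ∘ g ≃ id` via `R`-equivariant
homotopies of bidegree `(1, 1)`. -/
def HomotopyEquivCx (C₁ C₂ : PreCx) : Prop :=
  ∃ (f : Msub C₁ →ₗ[RUV] Msub C₂) (g : Msub C₂ →ₗ[RUV] Msub C₁)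
    (H : Msub C₁ →ₗ[RUV] Msub C₁) (K : Msub C₂ →ₗ[RUV] Msub C₂),
    (∀ x, f (dmap C₁ x) = dmap C₂ (f x)) ∧
    (∀ y, g (dmap C₂ y) = dmap C₁ (g y)) ∧
    MapHomogShift C₁ C₂ f 0 0 ∧ MapHomogShift C₂ C₁ g 0 0 ∧
    MapHomogShift C₁ C₁ H 1 1 ∧ MapHomogShift C₂ C₂ K 1 1 ∧
    (∀ x, g (f x) - x = dmap C₁ (H x) + H (dmap C₁ x)) ∧
    (∀ y, f (g y) - y = dmap C₂ (K y) + K (dmap C₂ y))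

/-- An isomorphism of bigraded chain complexes over `R`. -/
def IsBigradedChainIso (C₁ C₂ : PreCx) (f : Msub C₁ →ₗ[RUV] Msub C₂) : Prop :=
  Function.Bijective f ∧ (∀ x, f (dmap C₁ x) = dmap C₂ (f x)) ∧ MapHomogShift C₁ C₂ f 0 0

/-! ### Short maps -/

/-- A short map `f : C(b_1, …, b_n) ⇝ C`: an absolutely `U`-graded, relatively
`V`-graded `R`-module map which is a chain map at `x_1, …, x_{n-1}` and commutes with
the `V`-part of the differential at `x_n` (for reduced `C`, the failure
`∂ f(x_n) - f(∂_V x_n)` is exactly `∂_U f(x_n) ∈ U·C`). -/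
def IsShortMap (L : List ℤ) (C : PreCx) (f : Msub (StdCx L) →ₗ[RUV] Msub C) : Prop :=
  (∃ s : ℤ, MapHomogShift (StdCx L) C f 0 s) ∧
  (∀ i : Fin (L.length + 1), 1 ≤ (i : ℕ) → (i : ℕ) + 1 ≤ L.length →
    f (dmap (StdCx L) (Finsupp.single i 1)) = dmap C (f (Finsupp.single i 1))) ∧
  dmap C (f (Finsupp.single (Fin.last L.length) 1)) -
    f (dmap (StdCx L) (Finsupp.single (Fin.last L.length) 1)) ∈ uSub C

/-- A short local map: a short map sending the `V`-tower generator `x_0` to a `V`-tower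
generator (hence inducing an isomorphism on `H_*(·/U)/(V-torsion)`). -/
def IsShortLocalMap (L : List ℤ) (C : PreCx) (f : Msub (StdCx L) →ₗ[RUV] Msub C) : Prop :=
  IsShortMap L C f ∧ IsVTowerGen C (f (Finsupp.single (0 : Fin (L.length + 1)) 1))

/-- A local map from the semistandard complex `C'(b_1, …, b_n)` to a knot-like complex:
a grading-preserving `R`-equivariant chain map under which the class of `x_0`
generates `H_*(C/U)/(V-torsion)`. -/
def IsSemiLocalMap (L : List ℤ) (C : PreCx) (f : Msub (SemiStdCx L) →ₗ[RUV] Msub C) : Prop :=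
  (∀ x, f (dmap (SemiStdCx L) x) = dmap C (f x)) ∧
  MapHomogShift (SemiStdCx L) C f 0 0 ∧
  IsVTowerGen C (f (Finsupp.single (0 : Fin (L.length + 1)) 1))

/-! ### The order `Z^!` and the numerical invariants -/

/-- The embedding of `Z^!` into `ℚ` realizing the order
`-1 <^! -2 <^! ⋯ <^! 0 <^! ⋯ <^! 2 <^! 1`: send `0 ↦ 0` and `a ↦ 1/a` otherwise. -/
def qval (a : ℤ) : ℚ := if a = 0 then 0 else 1 / (a : ℚ)

/-- The order `≤^!` on `Z^!`. -/
def bangLE (a b : ℤ) : Prop := qval a ≤ qval b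

/-- Pad a finite sequence with trailing zeros. -/
def seqPad (L : List ℤ) (i : ℕ) : ℤ := L.getD i 0

/-- The lexicographic order on finite integer sequences induced by `≤^!`, padding the
shorter sequence with trailing zeros. -/
def bangLexLE (L₁ L₂ : List ℤ) : Prop :=
  (∀ i, seqPad L₁ i = seqPad L₂ i) ∨
    ∃ k, (∀ i < k, seqPad L₁ i = seqPad L₂ i) ∧ qval (seqPad L₁ k) < qval (seqPad L₂ k)

/-- `m` is an upper bound for `S ⊆ Z^!` with respect to `≤^!`. -/
def IsBangUB (S : Set ℤ) (m : ℤ) : Prop := ∀ b ∈ S, qval b ≤ qval m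

/-- `m = sup^! S`, the least upper bound of `S ⊆ Z^!` with respect to `≤^!`. -/
def IsBangLUB (S : Set ℤ) (m : ℤ) : Prop :=
  IsBangUB S m ∧ ∀ m' : ℤ, IsBangUB S m' → qval m ≤ qval m'

/-- Candidate set for the next invariant: given the already-constructed prefix `P`,
those nonzero `b` such that some standard complex `C(P, b, rest) ≤ C`. -/
def candSet (C : PreCx) (P : List ℤ) : Set ℤ :=
  {b | b ≠ 0 ∧ ∃ rest : List ℤ, IsStdSeq (P ++ b :: rest) ∧ LocalLE (StdCx (P ++ b :: rest)) C}

/-- `a` is the sequence of numerical invariants `a_i(C)` (indexed from `0`):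
once a term vanishes all later terms vanish, and otherwise each term is
`sup^!` of the corresponding candidate set. -/
def InvSeq (C : PreCx) (a : ℕ → ℤ) : Prop :=
  ∀ k : ℕ,
    ((∃ i < k, a i = 0) → a k = 0) ∧
    ((∀ i < k, a i ≠ 0) → IsBangLUB (candSet C ((List.range k).map a)) (a k))

/-- The first `n` terms of `a`, with the (all-zero) tail deleted. -/
def truncSeq (a : ℕ → ℤ) (n : ℕ) : List ℤ :=
  ((List.range n).map a).takeWhile (fun b => b != 0)

/-! ### The homomorphisms `φ_j`, `P` and the shifts `sh_m` -/

/-- `φ_j` of a standard complex `C(a_1, …, a_n)`: the signed count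
`#{i odd : a_i = j} − #{i odd : a_i = −j}` (with 1-based odd `i`). -/
def phi (j : ℕ) (L : List ℤ) : ℤ :=
  ∑ i ∈ Finset.range L.length,
    if i % 2 = 0 then
      (if L.getD i 0 = (j : ℤ) then 1 else 0) - (if L.getD i 0 = -(j : ℤ) then 1 else 0)
    else 0

/-- The shift `sh_m` on parameter sequences: entries of absolute value `≥ m` are pushed
one further from zero; entries of absolute value `< m` are fixed. -/
def shSeq (m : ℕ) (L : List ℤ) : List ℤ :=
  L.map fun a => if (m : ℤ) ≤ a then a + 1 else if a ≤ -(m : ℤ) then a - 1 else a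

/-- `P(C) = -2 ∑_{j>0} j φ_j(C) + ∑_i sgn a_i`, computed from the parameter sequence of
the standard representative (the sum over `j` is finite since `φ_j` vanishes for
`j` larger than any `|a_i|`). -/
def Pval (L : List ℤ) : ℤ :=
  -2 * (∑ j ∈ Finset.range ((L.map Int.natAbs).sum + 1), (j : ℤ) * phi j L) +
    (L.map Int.sign).sum

end

namespace ShiftHom

open Polynomial Matrix
open scoped Kronecker

/-! ### The ring `R` as a fibre product of two polynomial rings -/

theorem Uv_mul_Vv : Uv * Vv = 0 :=
  Ideal.Quotient.eq_zero_iff_mem.2 (Ideal.subset_span rfl)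

/-- The projection `R → R/V = 𝔽₂[U]`. -/
noncomputable def projU : RUV →+* (ZMod 2)[X] :=
  Ideal.Quotient.lift IUV (MvPolynomial.eval₂Hom C ![X, 0]) (by
    intro a ha
    obtain ⟨c, rfl⟩ := Ideal.mem_span_singleton.1 ha
    simp)

/-- The projection `R → R/U = 𝔽₂[V]`. -/
noncomputable def projV : RUV →+* (ZMod 2)[X] :=
  Ideal.Quotient.lift IUV (MvPolynomial.eval₂Hom C ![0, X]) (by
    intro a ha
    obtain ⟨c, rfl⟩ := Ideal.mem_span_singleton.1 ha
    simp)

/-- The coefficient inclusion `𝔽₂ → R`. -/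
noncomputable def coeffIncl : ZMod 2 →+* RUV := (Ideal.Quotient.mk IUV).comp MvPolynomial.C

/-- The inclusion `𝔽₂[U] → R`. -/
noncomputable def inclU : (ZMod 2)[X] →+* RUV := eval₂RingHom coeffIncl Uv

/-- The inclusion `𝔽₂[V] → R`. -/
noncomputable def inclV : (ZMod 2)[X] →+* RUV := eval₂RingHom coeffIncl Vv

@[simp] theorem projU_Uv : projU Uv = X := by simp [projU, Uv]
@[simp] theorem projU_Vv : projU Vv = 0 := by simp [projU, Vv]
@[simp] theorem projV_Uv : projV Uv = 0 := by simp [projV, Uv]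
@[simp] theorem projV_Vv : projV Vv = X := by simp [projV, Vv]
@[simp] theorem projU_coeffIncl (c : ZMod 2) : projU (coeffIncl c) = C c := by
  simp [projU, coeffIncl]
@[simp] theorem projV_coeffIncl (c : ZMod 2) : projV (coeffIncl c) = C c := by
  simp [projV, coeffIncl]
@[simp] theorem inclU_C (c : ZMod 2) : inclU (C c) = coeffIncl c := by simp [inclU]
@[simp] theorem inclV_C (c : ZMod 2) : inclV (C c) = coeffIncl c := by simp [inclV]
@[simp] theorem inclU_X : inclU X = Uv := by simp [inclU]
@[simp] theorem inclV_X : inclV X = Vv := by simp [inclV]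

theorem projU_inclU (p : (ZMod 2)[X]) : projU (inclU p) = p := by
  induction p using Polynomial.induction_on' with
  | add p q hp hq => simp [hp, hq]
  | monomial n a => simp [← C_mul_X_pow_eq_monomial]

theorem projV_inclV (p : (ZMod 2)[X]) : projV (inclV p) = p := by
  induction p using Polynomial.induction_on' with
  | add p q hp hq => simp [hp, hq]
  | monomial n a => simp [← C_mul_X_pow_eq_monomial]

theorem projU_inclV (p : (ZMod 2)[X]) : projU (inclV p) = C (p.coeff 0) := by
  conv_lhs => rw [← divX_mul_X_add p]
  simp

theorem projV_inclU (p : (ZMod 2)[X]) : projV (inclU p) = C (p.coeff 0) := by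
  conv_lhs => rw [← divX_mul_X_add p]
  simp

theorem Uv_mul_inclV (p : (ZMod 2)[X]) : Uv * inclV p = Uv * coeffIncl (p.coeff 0) := by
  conv_lhs => rw [← divX_mul_X_add p]
  simp only [map_add, map_mul, inclV_X, inclV_C]
  linear_combination inclV p.divX * Uv_mul_Vv

theorem Vv_mul_inclU (p : (ZMod 2)[X]) : Vv * inclU p = Vv * coeffIncl (p.coeff 0) := by
  conv_lhs => rw [← divX_mul_X_add p]
  simp only [map_add, map_mul, inclU_X, inclU_C]
  linear_combination inclU p.divX * Uv_mul_Vv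

theorem eq_incl_add_incl (r : RUV) :
    r = inclU (projU r) + inclV (projV r) - coeffIncl ((projV r).coeff 0) ∧
      (projU r).coeff 0 = (projV r).coeff 0 := by
  obtain ⟨p, rfl⟩ := Ideal.Quotient.mk_surjective r
  induction p using MvPolynomial.induction_on with
  | C a =>
    change coeffIncl a = inclU (projU (coeffIncl a)) + inclV (projV (coeffIncl a)) -
      coeffIncl ((projV (coeffIncl a)).coeff 0) ∧
        (projU (coeffIncl a)).coeff 0 = (projV (coeffIncl a)).coeff 0
    simp
  | add p q hp hq =>
    refine ⟨?_, by simp [hp.2, hq.2]⟩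
    conv_lhs => rw [map_add, hp.1, hq.1]
    simp only [map_add, coeff_add]
    ring
  | mul_X p i hp =>
    have key : ∀ r : RUV, (r = inclU (projU r) + inclV (projV r) -
        coeffIncl ((projV r).coeff 0) ∧ (projU r).coeff 0 = (projV r).coeff 0) →
        (r * Uv = inclU (projU (r * Uv)) + inclV (projV (r * Uv)) -
          coeffIncl ((projV (r * Uv)).coeff 0) ∧
          (projU (r * Uv)).coeff 0 = (projV (r * Uv)).coeff 0) ∧
        (r * Vv = inclU (projU (r * Vv)) + inclV (projV (r * Vv)) -
          coeffIncl ((projV (r * Vv)).coeff 0) ∧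
          (projU (r * Vv)).coeff 0 = (projV (r * Vv)).coeff 0) := by
      rintro r ⟨h, h0⟩
      refine ⟨⟨?_, by simp⟩, ⟨?_, by simp⟩⟩
      · simp only [map_mul, projU_Uv, projV_Uv, inclU_X, mul_zero, map_zero, coeff_zero]
        linear_combination Uv * h + Uv_mul_inclV (projV r)
      · have h1 := Vv_mul_inclU (projU r)
        rw [h0] at h1
        simp only [map_mul, projU_Vv, projV_Vv, inclV_X, mul_zero, map_zero, coeff_mul_X_zero]
        linear_combination Vv * h + h1
    rw [map_mul]
    fin_cases i
    · exact (key _ hp).1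
    · exact (key _ hp).2

theorem projU_coeff_zero (r : RUV) : (projU r).coeff 0 = (projV r).coeff 0 :=
  (eq_incl_add_incl r).2

theorem proj_ext {r s : RUV} (hU : projU r = projU s) (hV : projV r = projV s) : r = s := by
  rw [(eq_incl_add_incl r).1, (eq_incl_add_incl s).1, hU, hV]

theorem exists_glue (p q : (ZMod 2)[X]) (h : p.coeff 0 = q.coeff 0) :
    ∃ r : RUV, projU r = p ∧ projV r = q := by
  refine ⟨inclU p + inclV q - coeffIncl (q.coeff 0), ?_, ?_⟩
  · simp [projU_inclU, projU_inclV]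
  · simp [projV_inclU, projV_inclV, h]

theorem exists_eq_Uv_mul {r : RUV} (h : projV r = 0) : ∃ s, r = Uv * s := by
  refine ⟨inclU (projU r).divX, proj_ext ?_ (by simp [h])⟩
  have h0 : (projU r).coeff 0 = 0 := by rw [projU_coeff_zero, h, coeff_zero]
  rw [map_mul, projU_Uv, projU_inclU]
  conv_lhs => rw [← divX_mul_X_add (projU r), h0]
  simp [mul_comm]

theorem eq_one_of_mul_eq_one {p q : (ZMod 2)[X]} (h : p * q = 1) : q = 1 := by
  obtain ⟨c, hc, rfl⟩ := Polynomial.isUnit_iff.1 (IsUnit.of_mul_eq_one_right p h)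
  have : ∀ c : ZMod 2, IsUnit c → c = 1 := by
    intro c hc
    have := hc.ne_zero
    revert this
    clear hc
    revert c
    decide
  rw [this c hc, C_1]

/-! ### Simplified complexes over `𝔽₂[X]` and reindexing of arrow lengths -/

/-- A partial matching of a basis: `arrow i j` means that the differential of a simplified
complex sends the `i`-th basis vector to a power of `X` times the `j`-th one, and `len`
records the exponent.  Unmatched basis vectors have length `N`, which is larger than the length
of every arrow. -/
structure Matching (ι : Type) (N : ℕ) where
  arrow : ι → ι → Prop
  len : ι → ℕ
  arrow_right_unique : ∀ {i j k}, arrow i j → arrow i k → j = k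
  arrow_left_unique : ∀ {i j k}, arrow i k → arrow j k → i = j
  not_arrow_arrow : ∀ {i j k}, arrow i j → ¬ arrow j k
  len_eq : ∀ {i j}, arrow i j → len i = len j
  len_lt : ∀ {i j}, arrow i j → len i < N
  len_unmatched : ∀ {i}, (∀ j, ¬ arrow i j) → (∀ j, ¬ arrow j i) → len i = N

namespace Matching

variable {ι κ : Type} {N : ℕ}

open Classical in
/-- The differential of the simplified complex of a matching, after the arrow lengths have
been changed by `σ`. -/
noncomputable def diff (A : Matching ι N) (σ : ℕ → ℕ) : Matrix ι ι (ZMod 2)[X] :=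
  fun i j => if A.arrow i j then X ^ σ (A.len i) else 0

theorem len_le (A : Matching ι N) (i : ι) : A.len i ≤ N := by
  by_cases h : ∃ j, A.arrow i j
  · obtain ⟨j, hj⟩ := h
    exact (A.len_lt hj).le
  by_cases h' : ∃ j, A.arrow j i
  · obtain ⟨j, hj⟩ := h'
    exact (A.len_eq hj ▸ A.len_lt hj).le
  push Not at h h'
  exact (A.len_unmatched h h').le

theorem trichotomy (A : Matching ι N) (i : ι) :
    (∃ p, (∀ j, A.arrow i j ↔ j = p) ∧ (∀ j, A.arrow j p ↔ j = i) ∧ (∀ j, ¬ A.arrow j i) ∧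
      (∀ j, ¬ A.arrow p j) ∧ A.len p = A.len i ∧ A.len i < N) ∨
    (∃ p, (∀ j, A.arrow j i ↔ j = p) ∧ (∀ j, A.arrow p j ↔ j = i) ∧ (∀ j, ¬ A.arrow i j) ∧
      (∀ j, ¬ A.arrow j p) ∧ A.len p = A.len i ∧ A.len i < N) ∨
    ((∀ j, ¬ A.arrow i j) ∧ (∀ j, ¬ A.arrow j i) ∧ A.len i = N) := by
  by_cases h : ∃ j, A.arrow i j
  · obtain ⟨p, hp⟩ := h
    refine Or.inl ⟨p, fun j => ⟨fun hj => A.arrow_right_unique hj hp, fun e => e ▸ hp⟩,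
      fun j => ⟨fun hj => A.arrow_left_unique hj hp, fun e => e ▸ hp⟩,
      fun j hj => A.not_arrow_arrow hj hp, fun j => A.not_arrow_arrow hp, (A.len_eq hp).symm,
      A.len_lt hp⟩
  by_cases h' : ∃ j, A.arrow j i
  · obtain ⟨p, hp⟩ := h'
    refine Or.inr (Or.inl ⟨p, fun j => ⟨fun hj => A.arrow_left_unique hj hp, fun e => e ▸ hp⟩,
      fun j => ⟨fun hj => A.arrow_right_unique hj hp, fun e => e ▸ hp⟩,
      fun j => A.not_arrow_arrow hp, fun j hj => A.not_arrow_arrow hj hp, A.len_eq hp,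
      A.len_eq hp ▸ A.len_lt hp⟩)
  push Not at h h'
  exact Or.inr (Or.inr ⟨h, h', A.len_unmatched h h'⟩)

open Classical in
/-- The lift, to the simplified complexes with arrow lengths changed by `σ`, of the constant
part of a chain map `F` of simplified complexes. -/
noncomputable def lift {N' : ℕ} (A : Matching ι N) (B : Matching κ N') (σ : ℕ → ℕ)
    [Fintype ι] [Fintype κ] (F : Matrix ι κ (ZMod 2)[X]) : Matrix ι κ (ZMod 2)[X] :=
  fun i k => C ((F i k).coeff 0) +
    (∑ j, ∑ l, if A.arrow i j ∧ B.arrow k l ∧ B.len k < A.len i then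
      C ((F j l).coeff 0) * X ^ (σ (A.len i) - σ (B.len k)) else 0) +
    (∑ j, ∑ l, if A.arrow j i ∧ B.arrow l k ∧ A.len i < B.len k then
      C ((F j l).coeff 0) * X ^ (σ (B.len k) - σ (A.len i)) else 0)

theorem coeff_zero_lift {N' : ℕ} (A : Matching ι N) (B : Matching κ N') {σ : ℕ → ℕ}
    (hσ : StrictMono σ) [Fintype ι] [Fintype κ] (F : Matrix ι κ (ZMod 2)[X]) (i : ι) (k : κ) :
    (A.lift B σ F i k).coeff 0 = (F i k).coeff 0 := by
  simp only [lift, coeff_add, finsetSum_coeff, coeff_C_zero, add_assoc]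
  rw [Finset.sum_eq_zero, Finset.sum_eq_zero]
  · simp
  · intro j _
    refine Finset.sum_eq_zero fun l _ => ?_
    split_ifs with h
    · have := hσ h.2.2
      simp only [coeff_C_mul, coeff_X_pow]
      rw [if_neg (by omega), mul_zero]
    · simp
  · intro j _
    refine Finset.sum_eq_zero fun l _ => ?_
    split_ifs with h
    · have := hσ h.2.2
      simp only [coeff_C_mul, coeff_X_pow]
      rw [if_neg (by omega), mul_zero]
    · simp

theorem diff_mul_lift {N' : ℕ} (A : Matching ι N) (B : Matching κ N') {σ : ℕ → ℕ}
    (hσ : StrictMono σ) [Fintype ι] [Fintype κ] {F : Matrix ι κ (ZMod 2)[X]}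
    (hF : A.diff id * F = F * B.diff id) :
    A.diff σ * A.lift B σ F = A.lift B σ F * B.diff σ := by
  classical
  ext1 i k
  have h := congrFun (congrFun hF i) k
  simp only [Matrix.mul_apply, diff, ite_mul, mul_ite, zero_mul, mul_zero, id] at h ⊢
  by_cases hi : ∃ p, A.arrow i p <;> by_cases hk : ∃ q, B.arrow q k
  · obtain ⟨p, hp⟩ := hi
    obtain ⟨q, hq⟩ := hk
    have e1 : ∀ j, A.arrow i j ↔ j = p :=
      fun j => ⟨fun hj => A.arrow_right_unique hj hp, fun e => e ▸ hp⟩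
    have e2 : ∀ j, A.arrow j p ↔ j = i :=
      fun j => ⟨fun hj => A.arrow_left_unique hj hp, fun e => e ▸ hp⟩
    have e3 : ∀ j, B.arrow j k ↔ j = q :=
      fun j => ⟨fun hj => B.arrow_left_unique hj hq, fun e => e ▸ hq⟩
    have e4 : ∀ j, B.arrow q j ↔ j = k :=
      fun j => ⟨fun hj => B.arrow_right_unique hj hq, fun e => e ▸ hq⟩
    have n1 : ∀ j, ¬ A.arrow p j := fun j => A.not_arrow_arrow hp
    have n2 : ∀ j, ¬ A.arrow j i := fun j hj => A.not_arrow_arrow hj hp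
    have n3 : ∀ j, ¬ B.arrow k j := fun j => B.not_arrow_arrow hq
    have n4 : ∀ j, ¬ B.arrow j q := fun j hj => B.not_arrow_arrow hj hq
    have l1 := A.len_eq hp
    have l2 := B.len_eq hq
    simp only [e1, e3, Finset.sum_ite_eq', Finset.mem_univ, if_true] at h ⊢
    simp only [lift, e1, e2, e3, e4, n1, n2, n3, n4, false_and, and_false, if_false,
      Finset.sum_const_zero, add_zero, ite_and, Finset.sum_ite_irrel, Finset.sum_ite_eq',
      Finset.mem_univ, if_true, ← l1]
    rcases lt_trichotomy (A.len i) (B.len q) with hlt | heq | hgt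
    · have hs := hσ hlt
      have e : F p k = F i q * X ^ (B.len q - A.len i) := by
        refine mul_left_cancel₀ (pow_ne_zero (A.len i) X_ne_zero) ?_
        rw [h, ← Nat.sub_add_cancel hlt.le, pow_add]
        simp only [Nat.add_sub_cancel]
        ring
      have e0 : (F p k).coeff 0 = 0 := by
        rw [e, coeff_mul_X_pow', if_neg (by omega)]
      rw [if_pos (l2 ▸ hlt), if_neg hlt.not_gt, e0, ← l2]
      simp only [map_zero, zero_add, add_zero]
      rw [mul_left_comm, ← pow_add, Nat.add_sub_cancel' hs.le]
    · have e : F p k = F i q := by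
        refine mul_left_cancel₀ (pow_ne_zero (A.len i) X_ne_zero) ?_
        rw [h, heq]
        ring
      rw [if_neg (by omega), if_neg (by omega), e, heq]
      ring
    · have hs := hσ hgt
      have e : F i q = F p k * X ^ (A.len i - B.len q) := by
        refine mul_right_cancel₀ (pow_ne_zero (B.len q) X_ne_zero) ?_
        rw [← h, mul_assoc, ← pow_add, Nat.sub_add_cancel hgt.le]
        ring
      have e0 : (F i q).coeff 0 = 0 := by
        rw [e, coeff_mul_X_pow', if_neg (by omega)]
      rw [if_neg (by omega), if_pos hgt, e0]
      simp only [map_zero, zero_add, add_zero]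
      rw [mul_assoc, ← pow_add, Nat.sub_add_cancel hs.le]
      ring
  · obtain ⟨p, hp⟩ := hi
    push Not at hk
    have e1 : ∀ j, A.arrow i j ↔ j = p :=
      fun j => ⟨fun hj => A.arrow_right_unique hj hp, fun e => e ▸ hp⟩
    have n1 : ∀ j, ¬ A.arrow p j := fun j => A.not_arrow_arrow hp
    simp only [e1, hk, Finset.sum_ite_eq', Finset.mem_univ, if_true, if_false,
      Finset.sum_const_zero] at h ⊢
    have e : F p k = 0 := (mul_eq_zero.1 h).resolve_left (pow_ne_zero _ X_ne_zero)
    simp [lift, n1, hk, e]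
  · obtain ⟨q, hq⟩ := hk
    push Not at hi
    have e3 : ∀ j, B.arrow j k ↔ j = q :=
      fun j => ⟨fun hj => B.arrow_left_unique hj hq, fun e => e ▸ hq⟩
    have n4 : ∀ j, ¬ B.arrow j q := fun j hj => B.not_arrow_arrow hj hq
    simp only [e3, hi, Finset.sum_ite_eq', Finset.mem_univ, if_true, if_false,
      Finset.sum_const_zero] at h ⊢
    have e : F i q = 0 := (mul_eq_zero.1 h.symm).resolve_right (pow_ne_zero _ X_ne_zero)
    simp [lift, n4, hi, e]
  · push Not at hi hk
    simp [hi, hk]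

/-- The matching of the tensor product of two simplified complexes. -/
def prod (A : Matching ι N) (B : Matching κ N) : Matching (ι × κ) N where
  arrow i j := (A.len i.1 ≤ B.len i.2 ∧ A.arrow i.1 j.1 ∧ j.2 = i.2) ∨
    (B.len i.2 < A.len i.1 ∧ j.1 = i.1 ∧ B.arrow i.2 j.2)
  len i := min (A.len i.1) (B.len i.2)
  arrow_right_unique := by
    rintro ⟨i, i'⟩ ⟨j, j'⟩ ⟨k, k'⟩ (⟨h, h1, h2⟩ | ⟨h, h1, h2⟩) (⟨g, g1, g2⟩ | ⟨g, g1, g2⟩) <;>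
      dsimp only at *
    · rw [A.arrow_right_unique h1 g1, h2, g2]
    · omega
    · omega
    · rw [B.arrow_right_unique h2 g2, h1, g1]
  arrow_left_unique := by
    rintro ⟨i, i'⟩ ⟨j, j'⟩ ⟨k, k'⟩ (⟨h, h1, h2⟩ | ⟨h, h1, h2⟩) (⟨g, g1, g2⟩ | ⟨g, g1, g2⟩) <;>
      dsimp only at *
    · rw [A.arrow_left_unique h1 g1, ← h2, ← g2]
    · have := A.len_eq h1
      have := B.len_eq g2
      subst h2 g1
      omega
    · have := B.len_eq h2
      have := A.len_eq g1
      subst h1 g2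
      omega
    · rw [B.arrow_left_unique h2 g2, ← h1, ← g1]
  not_arrow_arrow := by
    rintro ⟨i, i'⟩ ⟨j, j'⟩ ⟨k, k'⟩ (⟨h, h1, h2⟩ | ⟨h, h1, h2⟩) (⟨g, g1, g2⟩ | ⟨g, g1, g2⟩) <;>
      dsimp only at *
    · exact A.not_arrow_arrow h1 g1
    · have := A.len_eq h1
      subst h2
      omega
    · have := B.len_eq h2
      subst h1
      omega
    · exact B.not_arrow_arrow h2 g2
  len_eq := by
    rintro ⟨i, i'⟩ ⟨j, j'⟩ (⟨h, h1, h2⟩ | ⟨h, h1, h2⟩) <;> dsimp only at *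
    · rw [A.len_eq h1, h2]
    · rw [B.len_eq h2, h1]
  len_lt := by
    rintro ⟨i, i'⟩ ⟨j, j'⟩ (⟨h, h1, h2⟩ | ⟨h, h1, h2⟩) <;> dsimp only at *
    · exact (min_le_left _ _).trans_lt (A.len_lt h1)
    · exact (min_le_right _ _).trans_lt (B.len_lt h2)
  len_unmatched := by
    rintro ⟨i, i'⟩ h h'
    have hA := A.len_le i
    have hB := B.len_le i'
    dsimp only at h h' ⊢
    by_contra hne
    rcases le_or_gt (A.len i) (B.len i') with hle | hlt
    · obtain ⟨p, h1, -⟩ | ⟨p, h1, h2, h3, h4, h5, h6⟩ | ⟨h1, h2, h3⟩ := A.trichotomy i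
      · exact h (p, i') (Or.inl ⟨hle, (h1 p).2 rfl, rfl⟩)
      · exact h' (p, i') (Or.inl ⟨by dsimp only; omega, (h1 p).2 rfl, rfl⟩)
      · omega
    · obtain ⟨p, h1, -⟩ | ⟨p, h1, h2, h3, h4, h5, h6⟩ | ⟨h1, h2, h3⟩ := B.trichotomy i'
      · exact h (i, p) (Or.inr ⟨hlt, rfl, (h1 p).2 rfl⟩)
      · exact h' (i, p) (Or.inr ⟨by dsimp only; omega, rfl, (h1 p).2 rfl⟩)
      · omega

end Matching

section Tensor

variable {ι κ : Type} {N : ℕ}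

/-- The differential `d₁ ⊗ 1 + 1 ⊗ d₂` of a tensor product. -/
def tensorDiff [DecidableEq ι] [DecidableEq κ] {S : Type} [CommRing S] (d₁ : Matrix ι ι S) (d₂ : Matrix κ κ S) :
    Matrix (ι × κ) (ι × κ) S :=
  d₁ ⊗ₖ 1 + 1 ⊗ₖ d₂

theorem tensorDiff_mul_kronecker [Fintype ι] [Fintype κ] [DecidableEq ι] [DecidableEq κ]
    {S ι' κ' : Type} [CommRing S] [Fintype ι'] [Fintype κ']
    [DecidableEq ι'] [DecidableEq κ'] {d₁ : Matrix ι ι S} {d₂ : Matrix κ κ S}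
    {d₁' : Matrix ι' ι' S} {d₂' : Matrix κ' κ' S} {F : Matrix ι ι' S} {G : Matrix κ κ' S}
    (hF : d₁ * F = F * d₁') (hG : d₂ * G = G * d₂') :
    tensorDiff d₁ d₂ * (F ⊗ₖ G) = (F ⊗ₖ G) * tensorDiff d₁' d₂' := by
  simp only [tensorDiff, Matrix.add_mul, Matrix.mul_add, ← Matrix.mul_kronecker_mul,
    Matrix.one_mul, Matrix.mul_one, hF, hG]

theorem map_tensorDiff [DecidableEq ι] [DecidableEq κ] {S T : Type} [CommRing S] [CommRing T] (φ : S →+* T)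
    (d₁ : Matrix ι ι S) (d₂ : Matrix κ κ S) :
    (tensorDiff d₁ d₂).map φ = tensorDiff (d₁.map φ) (d₂.map φ) := by
  ext ⟨i, i'⟩ ⟨j, j'⟩
  simp [tensorDiff, Matrix.one_apply, apply_ite φ]

namespace Matching

open Classical in
/-- The nilpotent part of the change of basis that simplifies the tensor product of two
simplified complexes. -/
noncomputable def twist (A : Matching ι N) (B : Matching κ N) (σ : ℕ → ℕ) :
    Matrix (ι × κ) (ι × κ) (ZMod 2)[X] :=
  fun i j =>
    (if A.len i.1 ≤ B.len i.2 ∧ A.arrow j.1 i.1 ∧ B.arrow i.2 j.2 then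
      X ^ (σ (B.len i.2) - σ (A.len i.1)) else 0) +
    (if B.len i.2 < A.len i.1 ∧ A.arrow i.1 j.1 ∧ B.arrow j.2 i.2 then
      X ^ (σ (A.len i.1) - σ (B.len i.2)) else 0)

theorem map_twist (A : Matching ι N) (B : Matching κ N) {σ : ℕ → ℕ} (hσ : StrictMono σ) :
    (A.twist B σ).map constantCoeff = (A.twist B id).map constantCoeff := by
  ext i j
  have key : ∀ a b : ℕ, a ≤ b → (constantCoeff (X ^ (σ b - σ a)) : ZMod 2) =
      constantCoeff (X ^ (b - a)) := by
    intro a b hab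
    rcases hab.eq_or_lt with rfl | hlt
    · simp
    · have := hσ hlt
      simp only [constantCoeff_apply, coeff_X_pow]
      rw [if_neg (by omega), if_neg (by omega)]
  simp only [Matrix.map_apply, twist, map_add, id]
  congr 1
  · split_ifs with h
    · exact key _ _ h.1
    · rfl
  · split_ifs with h
    · exact key _ _ h.1.le
    · rfl

theorem twist_mul_twist [Fintype ι] [Fintype κ] (A : Matching ι N) (B : Matching κ N) (σ : ℕ → ℕ) :
    A.twist B σ * A.twist B σ = 0 := by
  classical
  ext1 ⟨i, i'⟩ ⟨j, j'⟩
  rw [Matrix.mul_apply, Matrix.zero_apply]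
  refine Finset.sum_eq_zero ?_
  rintro ⟨k, k'⟩ -
  simp only [twist]
  by_cases h1 : A.arrow k i ∧ B.arrow i' k'
  · have := A.len_eq h1.1
    have := B.len_eq h1.2
    have n1 := A.not_arrow_arrow (k := j) h1.1
    have n2 := B.not_arrow_arrow (k := j') h1.2
    have n3 : ¬ A.arrow i k := A.not_arrow_arrow h1.1
    by_cases h2 : A.len i ≤ B.len i'
    · simp only [n2, n3, and_false, false_and, if_false, zero_add, add_zero]
      rw [if_neg (c := B.len k' < A.len k ∧ _) (by omega), mul_zero]
    · simp [n3, h2]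
  by_cases h3 : A.arrow i k ∧ B.arrow k' i'
  · have := A.len_eq h3.1
    have := B.len_eq h3.2
    have n1 := A.not_arrow_arrow (k := j) h3.1
    have n3 : ¬ A.arrow k i := A.not_arrow_arrow h3.1
    by_cases h2 : B.len i' < A.len i
    · simp only [n1, n3, and_false, false_and, if_false, zero_add, add_zero]
      rw [if_neg (c := A.len k ≤ B.len k' ∧ _) (by omega), mul_zero]
    · simp [n3, h2]
  simp [h1, h3]

theorem one_add_twist_mul_self [Fintype ι] [Fintype κ] [DecidableEq ι] [DecidableEq κ]
    (A : Matching ι N) (B : Matching κ N) (σ : ℕ → ℕ) :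
    (1 + A.twist B σ) * (1 + A.twist B σ) = 1 := by
  rw [Matrix.add_mul, Matrix.mul_add, Matrix.mul_add, twist_mul_twist]
  simp only [Matrix.one_mul, Matrix.mul_one, add_zero]
  rw [add_assoc]
  convert add_zero _
  ext1 i j
  exact CharTwo.add_self_eq_zero _

theorem twist_mul_tensorDiff [Fintype ι] [Fintype κ] [DecidableEq ι] [DecidableEq κ]
    (A : Matching ι N) (B : Matching κ N) {σ : ℕ → ℕ}
    (hσ : StrictMono σ) :
    (1 + A.twist B σ) * tensorDiff (A.diff σ) (B.diff σ) =
      (A.prod B).diff σ * (1 + A.twist B σ) := by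
  classical
  rw [Matrix.add_mul, Matrix.mul_add, Matrix.one_mul, Matrix.mul_one]
  ext1 ⟨i, i'⟩ ⟨j, j'⟩
  simp only [Matrix.add_apply, Matrix.mul_apply, Fintype.sum_prod_type, tensorDiff,
    Matrix.kroneckerMap_apply, Matrix.one_apply, diff, twist, prod, ite_and]
  have hexp : ∀ a b : ℕ, a ≤ b → (X ^ (σ b - σ a) : (ZMod 2)[X]) * X ^ σ a = X ^ σ b :=
    fun a b h => by rw [← pow_add, Nat.sub_add_cancel (hσ.monotone h)]
  obtain ⟨p, a1, a2, a3, a4, al, aN⟩ | ⟨p, a1, a2, a3, a4, al, aN⟩ | ⟨a1, a2, aN⟩ :=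
    A.trichotomy i <;>
  obtain ⟨q, b1, b2, b3, b4, bl, bN⟩ | ⟨q, b1, b2, b3, b4, bl, bN⟩ | ⟨b1, b2, bN⟩ :=
    B.trichotomy i' <;>
  rcases le_or_gt (A.len i) (B.len i') with hle | hlt <;>
  first
  | (exfalso; omega)
  | skip
  all_goals
    clear aN bN
    first
    | have hn : ¬ B.len i' < A.len i := hle.not_gt
      have hx := hexp _ _ hle
      have hx' := (mul_comm _ _).trans hx
      have hmin := min_eq_left hle
    | have hn : ¬ A.len i ≤ B.len i' := hlt.not_ge
      have hx := hexp _ _ hlt.le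
      have hx' := (mul_comm _ _).trans hx
      have hmin := min_eq_right hlt.le
    simp [*, Finset.sum_ite_irrel]
    try simp only [ite_and, Finset.sum_ite_irrel, Finset.sum_ite_eq', Finset.sum_const_zero,
      Finset.mem_univ, if_true]
    try simp [*]
  all_goals
    clear * -
    grind [CharTwo.add_self_eq_zero]

end Matching

end Tensor

/-! ### Shift-related differentials -/

/-- Two differentials over `𝔽₂[X]` on the same basis are `σ`-related if, after changes of basis
which agree modulo `X`, they become simplified with the same arrows, the lengths of the arrows of
the second being obtained from those of the first by applying `σ`. -/
def ShiftRelated {ι : Type} [Fintype ι] [DecidableEq ι] (σ : ℕ → ℕ)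
    (d d' : Matrix ι ι (ZMod 2)[X]) : Prop :=
  ∃ (N : ℕ) (A : Matching ι N) (P Q P' Q' : Matrix ι ι (ZMod 2)[X]),
    P * Q = 1 ∧ P' * Q' = 1 ∧ P.map constantCoeff = P'.map constantCoeff ∧
    Q.map constantCoeff = Q'.map constantCoeff ∧
    P * d = A.diff id * P ∧ P' * d' = A.diff σ * P'

theorem Matching.shiftRelated {ι : Type} [Fintype ι] [DecidableEq ι] {N : ℕ} (A : Matching ι N)
    (σ : ℕ → ℕ) : ShiftRelated σ (A.diff id) (A.diff σ) :=
  ⟨N, A, 1, 1, 1, 1, by simp, by simp, rfl, rfl, by simp, by simp⟩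

theorem Matching.shiftRelated_tensorDiff {ι κ : Type} [Fintype ι] [DecidableEq ι] [Fintype κ]
    [DecidableEq κ] {N : ℕ} (A : Matching ι N) (B : Matching κ N) {σ : ℕ → ℕ}
    (hσ : StrictMono σ) :
    ShiftRelated σ (tensorDiff (A.diff id) (B.diff id)) (tensorDiff (A.diff σ) (B.diff σ)) := by
  have h : (1 + A.twist B id).map constantCoeff = (1 + A.twist B σ).map constantCoeff := by
    rw [Matrix.map_add _ (map_add _), Matrix.map_add _ (map_add _), A.map_twist B hσ]
  exact ⟨N, A.prod B, 1 + A.twist B id, 1 + A.twist B id, 1 + A.twist B σ, 1 + A.twist B σ,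
    A.one_add_twist_mul_self B id, A.one_add_twist_mul_self B σ, h, h,
    A.twist_mul_tensorDiff B strictMono_id, A.twist_mul_tensorDiff B hσ⟩

/-- Transport of a matching along a bijection. -/
def Matching.comap {ι κ : Type} {N : ℕ} (A : Matching ι N) (e : κ ≃ ι) : Matching κ N where
  arrow i j := A.arrow (e i) (e j)
  len i := A.len (e i)
  arrow_right_unique h h' := e.injective (A.arrow_right_unique h h')
  arrow_left_unique h h' := e.injective (A.arrow_left_unique h h')
  not_arrow_arrow h := A.not_arrow_arrow h
  len_eq h := A.len_eq h
  len_lt h := A.len_lt h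
  len_unmatched h h' := A.len_unmatched
    (fun j => by simpa using h (e.symm j)) (fun j => by simpa using h' (e.symm j))

theorem ShiftRelated.submatrix {ι κ : Type} [Fintype ι] [DecidableEq ι] [Fintype κ]
    [DecidableEq κ] {σ : ℕ → ℕ} {d d' : Matrix ι ι (ZMod 2)[X]} (h : ShiftRelated σ d d')
    (e : κ ≃ ι) : ShiftRelated σ (d.submatrix e e) (d'.submatrix e e) := by
  obtain ⟨N, A, P, Q, P', Q', h1, h2, h3, h4, h5, h6⟩ := h
  have hA : ∀ τ, (A.comap e).diff τ = (A.diff τ).submatrix e e := fun τ => rfl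
  refine ⟨N, A.comap e, P.submatrix e e, Q.submatrix e e, P'.submatrix e e, Q'.submatrix e e,
    ?_, ?_, ?_, ?_, ?_, ?_⟩
  · rw [Matrix.submatrix_mul_equiv, h1, Matrix.submatrix_one_equiv]
  · rw [Matrix.submatrix_mul_equiv, h2, Matrix.submatrix_one_equiv]
  · exact congrArg (fun M => Matrix.submatrix M e e) h3
  · exact congrArg (fun M => Matrix.submatrix M e e) h4
  · rw [hA, Matrix.submatrix_mul_equiv, Matrix.submatrix_mul_equiv, h5]
  · rw [hA, Matrix.submatrix_mul_equiv, Matrix.submatrix_mul_equiv, h6]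

theorem ShiftRelated.exists_lift {ι κ : Type} [Fintype ι] [DecidableEq ι] [Fintype κ]
    [DecidableEq κ] {σ : ℕ → ℕ} (hσ : StrictMono σ) {d₁ d₁' : Matrix ι ι (ZMod 2)[X]}
    {d₂ d₂' : Matrix κ κ (ZMod 2)[X]} (h₁ : ShiftRelated σ d₁ d₁') (h₂ : ShiftRelated σ d₂ d₂')
    {F : Matrix ι κ (ZMod 2)[X]} (hF : d₁ * F = F * d₂) :
    ∃ F' : Matrix ι κ (ZMod 2)[X], d₁' * F' = F' * d₂' ∧
      F'.map constantCoeff = F.map constantCoeff := by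
  obtain ⟨N, A, P, Q, P', Q', hPQ, hPQ', cP, cQ, hd, hd'⟩ := h₁
  obtain ⟨M, B, R, S, R', S', hRS, hRS', cR, cS, he, he'⟩ := h₂
  have hQP := mul_eq_one_comm.1 hPQ
  have hSR := mul_eq_one_comm.1 hRS
  have hQP' := mul_eq_one_comm.1 hPQ'
  have hdQ' : d₁' * Q' = Q' * A.diff σ := by
    calc d₁' * Q' = Q' * (P' * d₁') * Q' := by
          rw [← Matrix.mul_assoc Q', hQP', Matrix.one_mul]
      _ = Q' * A.diff σ := by
          rw [hd', Matrix.mul_assoc, Matrix.mul_assoc, hPQ', Matrix.mul_one]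
  have hS : d₂ * S = S * B.diff id := by
    calc d₂ * S = S * (R * d₂) * S := by rw [← Matrix.mul_assoc S, hSR, Matrix.one_mul]
      _ = S * B.diff id := by rw [he, Matrix.mul_assoc, Matrix.mul_assoc, hRS, Matrix.mul_one]
  have hG : A.diff id * (P * F * S) = P * F * S * B.diff id := by
    calc A.diff id * (P * F * S) = A.diff id * P * F * S := by simp only [Matrix.mul_assoc]
      _ = P * (d₁ * F) * S := by rw [← hd]; simp only [Matrix.mul_assoc]
      _ = P * F * (d₂ * S) := by rw [hF]; simp only [Matrix.mul_assoc]
      _ = P * F * S * B.diff id := by rw [hS]; simp only [Matrix.mul_assoc]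
  have hL := A.diff_mul_lift B hσ hG
  have cL : (A.lift B σ (P * F * S)).map constantCoeff = (P * F * S).map constantCoeff := by
    ext i k
    exact A.coeff_zero_lift B hσ _ i k
  refine ⟨Q' * A.lift B σ (P * F * S) * R', ?_, ?_⟩
  · calc d₁' * (Q' * A.lift B σ (P * F * S) * R')
        = d₁' * Q' * A.lift B σ (P * F * S) * R' := by simp only [Matrix.mul_assoc]
      _ = Q' * (A.diff σ * A.lift B σ (P * F * S)) * R' := by
          rw [hdQ']; simp only [Matrix.mul_assoc]
      _ = Q' * A.lift B σ (P * F * S) * (B.diff σ * R') := by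
          rw [hL]; simp only [Matrix.mul_assoc]
      _ = Q' * A.lift B σ (P * F * S) * R' * d₂' := by rw [← he']; simp only [Matrix.mul_assoc]
  · rw [Matrix.map_mul, Matrix.map_mul, cL, ← cQ, ← cR, ← Matrix.map_mul, ← Matrix.map_mul]
    congr 1
    calc Q * (P * F * S) * R = Q * P * F * (S * R) := by simp only [Matrix.mul_assoc]
      _ = F := by rw [hQP, hSR, Matrix.one_mul, Matrix.mul_one]

/-! ### Homogeneous components -/

open Classical in
/-- The component of bidegree `p` of a polynomial in a variable of bidegree `(-2, 0)`. -/
noncomputable def homogComp (p : ℤ × ℤ) (f : (ZMod 2)[X]) : (ZMod 2)[X] :=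
  if p.2 = 0 ∧ ∃ a : ℕ, p.1 = -(2 * (a : ℤ)) then
    monomial (p.1.natAbs / 2) (f.coeff (p.1.natAbs / 2)) else 0

theorem homogComp_neg (a : ℕ) (f : (ZMod 2)[X]) :
    homogComp (-(2 * (a : ℤ)), 0) f = monomial a (f.coeff a) := by
  have : (-(2 * (a : ℤ))).natAbs / 2 = a := by omega
  rw [homogComp, if_pos ⟨rfl, a, rfl⟩]
  simp only [this]

theorem homogComp_eq_zero {p : ℤ × ℤ} (h : ¬ ∃ a : ℕ, p = (-(2 * (a : ℤ)), 0))
    (f : (ZMod 2)[X]) : homogComp p f = 0 :=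
  if_neg fun ⟨h2, a, h1⟩ => h ⟨a, Prod.ext h1 h2⟩

theorem homogComp_sum {ι : Type} (s : Finset ι) (p : ℤ × ℤ) (f : ι → (ZMod 2)[X]) :
    homogComp p (∑ i ∈ s, f i) = ∑ i ∈ s, homogComp p (f i) := by
  unfold homogComp
  split_ifs <;> simp

/-- Multiplication by `f` shifts homogeneous components by `p`. -/
def IsPolyHomog (f : (ZMod 2)[X]) (p : ℤ × ℤ) : Prop :=
  ∀ q g, homogComp (p + q) (f * g) = f * homogComp q g

theorem isPolyHomog_zero (p : ℤ × ℤ) : IsPolyHomog 0 p := by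
  intro q g
  simp [homogComp]

theorem isPolyHomog_X_pow (a : ℕ) : IsPolyHomog (X ^ a) (-(2 * (a : ℤ)), 0) := by
  intro q g
  by_cases h : ∃ b : ℕ, q = (-(2 * (b : ℤ)), 0)
  · obtain ⟨b, rfl⟩ := h
    have : ((-(2 * (a : ℤ)), 0) + (-(2 * (b : ℤ)), 0) : ℤ × ℤ) =
        (-(2 * ((a + b : ℕ) : ℤ)), 0) := by
      ext
      · push_cast
        simp only [Prod.mk_add_mk]
        ring
      · simp
    rw [this, homogComp_neg, homogComp_neg, X_pow_mul_monomial, coeff_X_pow_mul', add_comm b a,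
      if_pos (by omega), Nat.add_sub_cancel_left]
  · rw [homogComp_eq_zero h, mul_zero]
    by_cases h' : ∃ c : ℕ, (-(2 * (a : ℤ)), 0) + q = (-(2 * (c : ℤ)), 0)
    · obtain ⟨c, hc⟩ := h'
      have h1 := congrArg Prod.fst hc
      have h2 := congrArg Prod.snd hc
      simp only [Prod.fst_add, Prod.snd_add, zero_add] at h1 h2
      have hca : c < a := by
        by_contra hle
        exact h ⟨c - a, Prod.ext (by dsimp only; omega) h2⟩
      rw [hc, homogComp_neg, coeff_X_pow_mul', if_neg (by omega), monomial_zero_right]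
    · exact homogComp_eq_zero h' _

/-- The component of a matrix of bidegree `s` with respect to gradings of the bases. -/
noncomputable def homogMat {ι κ : Type} (g₁ : ι → ℤ × ℤ) (g₂ : κ → ℤ × ℤ) (s : ℤ × ℤ)
    (F : Matrix ι κ (ZMod 2)[X]) : Matrix ι κ (ZMod 2)[X] :=
  fun i k => homogComp (g₁ i + s - g₂ k) (F i k)

theorem mul_homogMat {ι κ : Type} [Fintype ι] [Fintype κ] {g₁ : ι → ℤ × ℤ} {g₂ : κ → ℤ × ℤ}
    {t : ℤ × ℤ} {d₁ : Matrix ι ι (ZMod 2)[X]} {d₂ : Matrix κ κ (ZMod 2)[X]}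
    (h₁ : ∀ i j, IsPolyHomog (d₁ i j) (g₁ i + t - g₁ j))
    (h₂ : ∀ i j, IsPolyHomog (d₂ i j) (g₂ i + t - g₂ j)) (s : ℤ × ℤ)
    {F : Matrix ι κ (ZMod 2)[X]} (hF : d₁ * F = F * d₂) :
    d₁ * homogMat g₁ g₂ s F = homogMat g₁ g₂ s F * d₂ := by
  ext1 i k
  have h := congrArg (homogComp (g₁ i + t + s - g₂ k)) (congrFun (congrFun hF i) k)
  rw [Matrix.mul_apply, Matrix.mul_apply, homogComp_sum, homogComp_sum] at h
  rw [Matrix.mul_apply, Matrix.mul_apply]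
  convert h using 2 with j _ j _
  · rw [homogMat, ← h₁ i j]
    congr 1
    abel
  · rw [homogMat, mul_comm, ← h₂ j k, mul_comm]
    congr 1
    abel

/-! ### Homogeneous lifts over `R` -/

theorem coeff_zero_homogComp (p : ℤ × ℤ) (f : (ZMod 2)[X]) :
    (homogComp p f).coeff 0 = if p = 0 then f.coeff 0 else 0 := by
  by_cases h : ∃ a : ℕ, p = (-(2 * (a : ℤ)), 0)
  · obtain ⟨a, rfl⟩ := h
    rw [homogComp_neg, coeff_monomial]
    by_cases ha : a = 0
    · simp [ha]
    · rw [if_neg ha, if_neg]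
      intro h
      have := congrArg Prod.fst h
      simp only [Prod.fst_zero] at this
      omega
  · rw [homogComp_eq_zero h, coeff_zero, if_neg]
    rintro rfl
    exact h ⟨0, rfl⟩

theorem zmod_two_eq_zero_or_one (c : ZMod 2) : c = 0 ∨ c = 1 := by
  revert c
  decide

theorem isHomog_of_proj {r : RUV} {p q : ℤ} {f g : (ZMod 2)[X]}
    (hf : projU r = homogComp (p, q) f) (hg : projV r = homogComp (q, p) g) : IsHomog r p q := by
  have h0 := projU_coeff_zero r
  by_cases h : ∃ a : ℕ, (p, q) = (-(2 * (a : ℤ)), 0)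
  · obtain ⟨a, ha⟩ := h
    obtain ⟨rfl, rfl⟩ := Prod.mk.injEq _ _ _ _ ▸ ha
    rw [homogComp_neg] at hf
    have hV : projV r = C ((projU r).coeff 0) := by
      by_cases ha : a = 0
      · subst ha
        have := homogComp_neg 0 g
        simp only [CharP.cast_eq_zero, mul_zero, neg_zero] at this hg
        rw [h0, hg, this, monomial_zero_left, coeff_C_zero]
      · rw [hg, hf, coeff_monomial, if_neg ha, C_0]
        apply homogComp_eq_zero
        rintro ⟨b, hb⟩
        have := congrArg Prod.snd hb
        dsimp only at this
        omega
    rcases zmod_two_eq_zero_or_one (f.coeff a) with hc | hc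
    · rw [hc, monomial_zero_right] at hf
      refine Or.inl (proj_ext ?_ ?_)
      · rw [hf, map_zero]
      · rw [hV, hf, coeff_zero, C_0, map_zero]
    · rw [hc, ← X_pow_eq_monomial] at hf
      refine Or.inr (Or.inl ⟨a, proj_ext ?_ ?_, rfl, rfl⟩)
      · rw [hf, map_pow, projU_Uv]
      · rw [hV, hf, map_pow, projV_Uv, coeff_X_pow]
        rcases Nat.eq_zero_or_pos a with rfl | ha
        · simp
        · rw [if_neg ha.ne, C_0, zero_pow ha.ne']
  rw [homogComp_eq_zero h] at hf
  rw [hf, coeff_zero] at h0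
  by_cases h' : ∃ a : ℕ, (q, p) = (-(2 * (a : ℤ)), 0)
  · obtain ⟨a, ha⟩ := h'
    obtain ⟨rfl, rfl⟩ := Prod.mk.injEq _ _ _ _ ▸ ha
    have ha : a ≠ 0 := by
      rintro rfl
      exact h ⟨0, by simp⟩
    rw [homogComp_neg] at hg
    rcases zmod_two_eq_zero_or_one (g.coeff a) with hc | hc
    · rw [hc, monomial_zero_right] at hg
      exact Or.inl (proj_ext (by rw [hf, map_zero]) (by rw [hg, map_zero]))
    · rw [hc, ← X_pow_eq_monomial] at hg
      refine Or.inr (Or.inr ⟨a, proj_ext ?_ ?_, rfl, rfl⟩)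
      · rw [hf, map_pow, projU_Vv, zero_pow ha]
      · rw [hg, map_pow, projV_Vv]
  · rw [homogComp_eq_zero h'] at hg
    exact Or.inl (proj_ext (by rw [hf, map_zero]) (by rw [hg, map_zero]))

theorem isPolyHomog_projU {r : RUV} {p q : ℤ} (h : IsHomog r p q) :
    IsPolyHomog (projU r) (p, q) := by
  rcases h with rfl | ⟨a, rfl, rfl, rfl⟩ | ⟨b, rfl, rfl, rfl⟩
  · rw [map_zero]
    exact isPolyHomog_zero _
  · rw [map_pow, projU_Uv]
    exact isPolyHomog_X_pow a
  · rw [map_pow, projU_Vv]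
    rcases Nat.eq_zero_or_pos b with rfl | hb
    · simpa using isPolyHomog_X_pow 0
    · rw [zero_pow hb.ne']
      exact isPolyHomog_zero _

theorem isPolyHomog_projV {r : RUV} {p q : ℤ} (h : IsHomog r p q) :
    IsPolyHomog (projV r) (q, p) := by
  rcases h with rfl | ⟨a, rfl, rfl, rfl⟩ | ⟨b, rfl, rfl, rfl⟩
  · rw [map_zero]
    exact isPolyHomog_zero _
  · rw [map_pow, projV_Uv]
    rcases Nat.eq_zero_or_pos a with rfl | ha
    · simpa using isPolyHomog_X_pow 0
    · rw [zero_pow ha.ne']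
      exact isPolyHomog_zero _
  · rw [map_pow, projV_Vv]
    exact isPolyHomog_X_pow b

/-- A matrix over `R` all of whose entries respect the gradings of the bases up to the shift `s`. -/
def HomogMatrix {ι κ : Type} (g₁ : ι → ℤ × ℤ) (g₂ : κ → ℤ × ℤ) (s : ℤ × ℤ)
    (M : Matrix ι κ RUV) : Prop :=
  ∀ i j, IsHomog (M i j) ((g₁ i).1 + s.1 - (g₂ j).1) ((g₁ i).2 + s.2 - (g₂ j).2)

/-- The differentials of two complexes over `R` are shift-related modulo `U` and modulo `V`. -/
def ShiftRelatedUV {ι : Type} [Fintype ι] [DecidableEq ι] (σ : ℕ → ℕ) (d d' : Matrix ι ι RUV) :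
    Prop :=
  ShiftRelated σ (d.map projU) (d'.map projU) ∧ ShiftRelated σ (d.map projV) (d'.map projV)

theorem ShiftRelatedUV.exists_lift {ι κ : Type} [Fintype ι] [DecidableEq ι] [Fintype κ]
    [DecidableEq κ] {σ : ℕ → ℕ} (hσ : StrictMono σ) {d₁ d₁' : Matrix ι ι RUV}
    {d₂ d₂' : Matrix κ κ RUV} (h₁ : ShiftRelatedUV σ d₁ d₁') (h₂ : ShiftRelatedUV σ d₂ d₂')
    {g₁ : ι → ℤ × ℤ} {g₂ : κ → ℤ × ℤ} (hg₁ : HomogMatrix g₁ g₁ (-1, -1) d₁')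
    (hg₂ : HomogMatrix g₂ g₂ (-1, -1) d₂') (s : ℤ × ℤ) {M : Matrix ι κ RUV}
    (hM : d₁ * M = M * d₂) :
    ∃ M' : Matrix ι κ RUV, d₁' * M' = M' * d₂' ∧ HomogMatrix g₁ g₂ s M' ∧
      ∀ i j, g₁ i + s = g₂ j → (projV (M' i j)).coeff 0 = (projV (M i j)).coeff 0 := by
  obtain ⟨F, hF, cF⟩ := h₁.1.exists_lift hσ h₂.1 (F := M.map projU)
    (by rw [← Matrix.map_mul, ← Matrix.map_mul, hM])
  obtain ⟨G, hG, cG⟩ := h₁.2.exists_lift hσ h₂.2 (F := M.map projV)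
    (by rw [← Matrix.map_mul, ← Matrix.map_mul, hM])
  have hFh := mul_homogMat (d₁ := d₁'.map projU) (d₂ := d₂'.map projU) (g₁ := g₁) (g₂ := g₂) (t := (-1, -1))
    (fun i j => isPolyHomog_projU (hg₁ i j)) (fun i j => isPolyHomog_projU (hg₂ i j)) s hF
  have hGh := mul_homogMat (d₁ := d₁'.map projV) (d₂ := d₂'.map projV) (g₁ := fun i => (g₁ i).swap)
    (g₂ := fun i => (g₂ i).swap) (t := (-1, -1))
    (fun i j => isPolyHomog_projV (hg₁ i j)) (fun i j => isPolyHomog_projV (hg₂ i j)) s.swap hG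
  have hFG : ∀ i j, (F i j).coeff 0 = (G i j).coeff 0 := by
    intro i j
    have h1 := congrFun (congrFun cF i) j
    have h2 := congrFun (congrFun cG i) j
    simp only [Matrix.map_apply, constantCoeff_apply] at h1 h2
    rw [h1, h2, projU_coeff_zero]
  have hglue : ∀ i j, ∃ r : RUV, projU r = homogMat g₁ g₂ s F i j ∧
      projV r = homogMat (fun i => (g₁ i).swap) (fun i => (g₂ i).swap) s.swap G i j := by
    intro i j
    apply exists_glue
    rw [homogMat, homogMat, coeff_zero_homogComp, coeff_zero_homogComp, hFG]
    congr 1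
    simp only [Prod.ext_iff, Prod.fst_sub, Prod.snd_sub, Prod.fst_add, Prod.snd_add,
      Prod.fst_swap, Prod.snd_swap, Prod.fst_zero, Prod.snd_zero, and_comm]
  choose r hrU hrV using hglue
  obtain ⟨M', hU', hV'⟩ : ∃ M' : Matrix ι κ RUV, M'.map projU = homogMat g₁ g₂ s F ∧
      M'.map projV = homogMat (fun i => (g₁ i).swap) (fun i => (g₂ i).swap) s.swap G :=
    ⟨Matrix.of r, Matrix.ext hrU, Matrix.ext hrV⟩
  have hU := fun i j => congrFun (congrFun hU' i) j
  have hV := fun i j => congrFun (congrFun hV' i) j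
  simp only [Matrix.map_apply] at hU hV
  refine ⟨M', ?_, ?_, ?_⟩
  · ext1 i j
    apply proj_ext
    · rw [← hU', ← Matrix.map_mul, ← Matrix.map_mul] at hFh
      exact congrFun (congrFun hFh i) j
    · rw [← hV', ← Matrix.map_mul, ← Matrix.map_mul] at hGh
      exact congrFun (congrFun hGh i) j
  · intro i j
    exact isHomog_of_proj (hU i j) (hV i j)
  · intro i j h
    have h2 := congrFun (congrFun cG i) j
    simp only [Matrix.map_apply, constantCoeff_apply] at h2
    rw [hV, homogMat, coeff_zero_homogComp, if_pos, h2]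
    rw [← h]
    simp

/-! ### Towers -/

/-- The polynomial counterpart of `IsVTowerGen`. -/
def IsTowerGen {ι : Type} [Fintype ι] (D : Matrix ι ι (ZMod 2)[X]) (x : ι → (ZMod 2)[X]) : Prop :=
  x ᵥ* D = 0 ∧ (∀ k : ℕ, ¬ ∃ w, (X : (ZMod 2)[X]) ^ k • x = w ᵥ* D) ∧
    ∀ z, z ᵥ* D = 0 → ∃ (r : (ZMod 2)[X]) (k : ℕ) (w : _),
      (X : (ZMod 2)[X]) ^ k • (z - r • x) = w ᵥ* D

/-- The basis vector `o` is a cycle not hit by the differential, and up to torsion the homology is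
freely generated by its class. -/
structure IsPointed {ι : Type} [Fintype ι] [DecidableEq ι] (D : Matrix ι ι (ZMod 2)[X])
    (o : ι) : Prop where
  row : ∀ j, D o j = 0
  col : ∀ i, D i o = 0
  contract : ∃ (N : ℕ) (H : Matrix ι ι (ZMod 2)[X]),
    D * H + H * D + (X : (ZMod 2)[X]) ^ N • Matrix.single o o 1 = (X : (ZMod 2)[X]) ^ N • 1

section

variable {ι κ : Type} [Fintype ι] [DecidableEq ι] [Fintype κ] [DecidableEq κ]

theorem vecMul_apply_eq_zero {D : Matrix ι ι (ZMod 2)[X]} {o : ι} (h : ∀ i, D i o = 0)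
    (w : ι → (ZMod 2)[X]) : (w ᵥ* D) o = 0 := by
  simp [Matrix.vecMul, dotProduct, h]

theorem IsPointed.exists_boundary {D : Matrix ι ι (ZMod 2)[X]} {o : ι} (h : IsPointed D o) :
    ∃ N : ℕ, ∀ x, x ᵥ* D = 0 →
      ∃ w, (X : (ZMod 2)[X]) ^ N • (x - x o • Pi.single o 1) = w ᵥ* D := by
  obtain ⟨N, H, hH⟩ := h.contract
  refine ⟨N, fun x hx => ⟨x ᵥ* H, ?_⟩⟩
  have h1 := congrArg (fun M => x ᵥ* M) hH
  simp only [Matrix.vecMul_add, ← Matrix.vecMul_vecMul, hx, Matrix.zero_vecMul, zero_add,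
    Matrix.vecMul_smul, Matrix.vecMul_one] at h1
  have h2 : x ᵥ* Matrix.single o o (1 : (ZMod 2)[X]) = x o • Pi.single o 1 := by
    ext1 j
    by_cases hj : o = j
    · subst hj
      simp [Matrix.vecMul, dotProduct, Matrix.single_apply]
    · simp [Matrix.vecMul, dotProduct, hj, Ne.symm hj]
  rw [smul_sub, ← h2, ← h1, add_sub_cancel_right]

theorem IsPointed.vecMul_apply {D₁ : Matrix ι ι (ZMod 2)[X]} {D₂ : Matrix κ κ (ZMod 2)[X]}
    {o₁ : ι} {o₂ : κ} (h₁ : IsPointed D₁ o₁) (h₂ : ∀ i, D₂ i o₂ = 0)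
    {M : Matrix ι κ (ZMod 2)[X]} (hM : D₁ * M = M * D₂) {x : ι → (ZMod 2)[X]}
    (hx : x ᵥ* D₁ = 0) : (x ᵥ* M) o₂ = x o₁ * M o₁ o₂ := by
  obtain ⟨N, hN⟩ := h₁.exists_boundary
  obtain ⟨w, hw⟩ := hN x hx
  have h := congrArg (fun y => (y ᵥ* M) o₂) hw
  simp only [Matrix.vecMul_vecMul, hM] at h
  rw [← Matrix.vecMul_vecMul, vecMul_apply_eq_zero h₂, Matrix.smul_vecMul, Matrix.sub_vecMul,
    Matrix.smul_vecMul, Matrix.single_one_vecMul] at h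
  simp only [Pi.smul_apply, Pi.sub_apply, smul_eq_mul, Matrix.row_apply] at h
  exact sub_eq_zero.1 ((mul_eq_zero.1 h).resolve_left (pow_ne_zero _ X_ne_zero))

theorem IsPointed.isTowerGen_iff {D : Matrix ι ι (ZMod 2)[X]} {o : ι} (h : IsPointed D o)
    {x : ι → (ZMod 2)[X]} : IsTowerGen D x ↔ x ᵥ* D = 0 ∧ x o = 1 := by
  constructor
  · rintro ⟨hx, -, hgen⟩
    refine ⟨hx, ?_⟩
    obtain ⟨r, k, w, hw⟩ := hgen (Pi.single o 1)
      (by rw [Matrix.single_one_vecMul]; exact funext h.row)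
    have h1 := congrFun hw o
    rw [vecMul_apply_eq_zero h.col] at h1
    simp only [Pi.smul_apply, Pi.sub_apply, smul_eq_mul, Pi.single_eq_same] at h1
    exact eq_one_of_mul_eq_one (sub_eq_zero.1
      ((mul_eq_zero.1 h1).resolve_left (pow_ne_zero _ X_ne_zero))).symm
  · rintro ⟨hx, hxo⟩
    obtain ⟨N, hN⟩ := h.exists_boundary
    refine ⟨hx, ?_, ?_⟩
    · rintro k ⟨w, hw⟩
      have h1 := congrFun hw o
      rw [vecMul_apply_eq_zero h.col, Pi.smul_apply, hxo, smul_eq_mul, mul_one] at h1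
      exact pow_ne_zero _ X_ne_zero h1
    · intro z hz
      have hz' : (z - z o • x) ᵥ* D = 0 := by
        rw [Matrix.sub_vecMul, Matrix.smul_vecMul, hz, hx, smul_zero, sub_zero]
      obtain ⟨w, hw⟩ := hN _ hz'
      refine ⟨z o, N, w, ?_⟩
      rw [← hw]
      simp [hxo]

theorem IsPointed.isTowerGen_single {D : Matrix ι ι (ZMod 2)[X]} {o : ι} (h : IsPointed D o) :
    IsTowerGen D (Pi.single o 1) :=
  h.isTowerGen_iff.2 ⟨by rw [Matrix.single_one_vecMul]; exact funext h.row, Pi.single_eq_same _ _⟩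

theorem IsPointed.submatrix {D : Matrix ι ι (ZMod 2)[X]} {o : ι} (h : IsPointed D o)
    (e : κ ≃ ι) : IsPointed (D.submatrix e e) (e.symm o) where
  row j := by simpa using h.row _
  col j := by simpa using h.col _
  contract := by
    obtain ⟨N, H, hH⟩ := h.contract
    refine ⟨N, H.submatrix e e, ?_⟩
    have h1 := congrArg (fun M => Matrix.submatrix M e e) hH
    simpa [Matrix.submatrix_mul_equiv, Matrix.submatrix_add, Matrix.submatrix_smul] using h1

theorem matrix_add_self (M : Matrix ι κ (ZMod 2)[X]) : M + M = 0 := by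
  ext1 i j
  exact CharTwo.add_self_eq_zero _

theorem IsPointed.tensorDiff {D₁ : Matrix ι ι (ZMod 2)[X]} {D₂ : Matrix κ κ (ZMod 2)[X]}
    {o₁ : ι} {o₂ : κ} (h₁ : IsPointed D₁ o₁) (h₂ : IsPointed D₂ o₂) :
    IsPointed (tensorDiff D₁ D₂) (o₁, o₂) where
  row j := by simp [ShiftHom.tensorDiff, h₁.row, h₂.row]
  col j := by simp [ShiftHom.tensorDiff, h₁.col, h₂.col]
  contract := by
    obtain ⟨N₁, H₁, e₁⟩ := h₁.contract
    obtain ⟨N₂, H₂, e₂⟩ := h₂.contract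
    set E : Matrix ι ι (ZMod 2)[X] := Matrix.single o₁ o₁ 1 with hE
    have hDE : D₁ * E = 0 := by
      ext1 i j
      by_cases hj : j = o₁
      · subst hj
        rw [hE, Matrix.mul_single_apply_same, h₁.col, zero_mul, Matrix.zero_apply]
      · rw [hE, Matrix.mul_single_apply_of_ne _ _ _ _ _ hj, Matrix.zero_apply]
    have hED : E * D₁ = 0 := by
      ext1 i j
      by_cases hi : i = o₁
      · subst hi
        rw [hE, Matrix.single_mul_apply_same, h₁.row, mul_zero, Matrix.zero_apply]
      · rw [hE, Matrix.single_mul_apply_of_ne _ _ _ _ _ hi, Matrix.zero_apply]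
    have hEE : Matrix.single (o₁, o₂) (o₁, o₂) (1 : (ZMod 2)[X]) =
        E ⊗ₖ Matrix.single o₂ o₂ 1 := by
      rw [hE, Matrix.single_kronecker_single, mul_one]
    refine ⟨N₁ + N₂, (X : (ZMod 2)[X]) ^ N₂ • (H₁ ⊗ₖ (1 : Matrix κ κ (ZMod 2)[X])) +
      (X : (ZMod 2)[X]) ^ N₁ • (E ⊗ₖ H₂), ?_⟩
    have hl : ShiftHom.tensorDiff D₁ D₂ * (H₁ ⊗ₖ 1) + (H₁ ⊗ₖ 1) * ShiftHom.tensorDiff D₁ D₂ +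
        (X : (ZMod 2)[X]) ^ N₁ • (E ⊗ₖ (1 : Matrix κ κ (ZMod 2)[X])) =
        (X : (ZMod 2)[X]) ^ N₁ • 1 := by
      have := congrArg (fun M => M ⊗ₖ (1 : Matrix κ κ (ZMod 2)[X])) e₁
      simp only [Matrix.add_kronecker, Matrix.smul_kronecker, Matrix.one_kronecker_one] at this
      rw [← this]
      simp only [ShiftHom.tensorDiff, Matrix.add_mul, Matrix.mul_add, ← Matrix.mul_kronecker_mul,
        Matrix.one_mul, Matrix.mul_one]
      have h0 := matrix_add_self (H₁ ⊗ₖ D₂)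
      rw [← sub_eq_zero, ← h0]
      abel
    have hr : ShiftHom.tensorDiff D₁ D₂ * (E ⊗ₖ H₂) + (E ⊗ₖ H₂) * ShiftHom.tensorDiff D₁ D₂ +
        (X : (ZMod 2)[X]) ^ N₂ • (E ⊗ₖ Matrix.single o₂ o₂ (1 : (ZMod 2)[X])) =
        (X : (ZMod 2)[X]) ^ N₂ • (E ⊗ₖ 1) := by
      have := congrArg (fun M => E ⊗ₖ M) e₂
      simp only [Matrix.kronecker_add, Matrix.kronecker_smul] at this
      rw [← this]
      simp only [ShiftHom.tensorDiff, Matrix.add_mul, Matrix.mul_add, ← Matrix.mul_kronecker_mul,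
        Matrix.one_mul, Matrix.mul_one, hDE, hED, Matrix.zero_kronecker, zero_add]
    have hl' := congrArg (fun M => (X : (ZMod 2)[X]) ^ N₂ • M) hl
    have hr' := congrArg (fun M => (X : (ZMod 2)[X]) ^ N₁ • M) hr
    simp only [smul_add, smul_smul] at hl' hr'
    rw [hEE, Matrix.mul_add, Matrix.add_mul]
    simp only [Matrix.mul_smul, Matrix.smul_mul, pow_add]
    have hc := mul_comm ((X : (ZMod 2)[X]) ^ N₁) (X ^ N₂)
    rw [hc] at hr' ⊢
    rw [← hl', ← hr']
    abel

theorem Matching.isPointed {N : ℕ} (A : Matching ι N) (σ : ℕ → ℕ) (hσ : StrictMono σ) {o : ι}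
    (h : ∀ i, i ≠ o → (∃ j, A.arrow i j) ∨ ∃ j, A.arrow j i) (ho : ∀ j, ¬ A.arrow o j)
    (ho' : ∀ j, ¬ A.arrow j o) : IsPointed (A.diff σ) o where
  row j := if_neg (ho j)
  col j := if_neg (ho' j)
  contract := by
    classical
    refine ⟨σ N, Matrix.of fun i j => if A.arrow j i then X ^ (σ N - σ (A.len i)) else 0, ?_⟩
    ext1 i j
    simp only [Matrix.add_apply, Matrix.mul_apply, Matrix.smul_apply, Matrix.of_apply, smul_eq_mul,
      Matching.diff, Matrix.one_apply, Matrix.single_apply, mul_ite, ite_mul, zero_mul, mul_zero,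
      mul_one]
    by_cases hi : i = o
    · subst hi
      simp only [ho, ho', if_false, Finset.sum_const_zero, zero_add, ite_self, true_and]
    have hpow : ∀ k, A.len k < N → (X : (ZMod 2)[X]) ^ σ (A.len k) * X ^ (σ N - σ (A.len k)) =
        X ^ σ N := by
      intro k hk
      rw [← pow_add, Nat.add_sub_cancel' (hσ hk).le]
    have hio : ¬ (o = i ∧ o = j) := fun h => hi h.1.symm
    rw [if_neg hio, add_zero]
    rcases A.trichotomy i with ⟨p, h1, h2, h3, h4, h5, h6⟩ | ⟨p, h1, h2, h3, h4, h5, h6⟩ |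
      ⟨h1, h2, -⟩
    · simp only [h1, h3, if_false, ite_self, Finset.sum_const_zero, add_zero]
      rw [Finset.sum_eq_single p (fun b _ hb => by simp [hb]) (by simp)]
      simp only [h2, h5, hpow i h6, if_true, @eq_comm _ j i]
    · simp only [h1, h3, if_false, ite_self, Finset.sum_const_zero, zero_add]
      rw [Finset.sum_eq_single p (fun b _ hb => by simp [hb]) (by simp)]
      simp only [h2, h5, mul_comm, hpow i h6, if_true, @eq_comm _ j i]
    · rcases h i hi with ⟨j, hj⟩ | ⟨j, hj⟩
      · exact absurd hj (h1 j)
      · exact absurd hj (h2 j)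

theorem coefficient_eq_one {μ : Type} [Fintype μ] {D : Matrix μ μ (ZMod 2)[X]}
    {D₁ : Matrix ι ι (ZMod 2)[X]} {D₂ : Matrix κ κ (ZMod 2)[X]} {o₁ : ι} {o₂ : κ}
    (h₁ : ∀ i, D₁ i o₁ = 0) (h₂ : ∀ i, D₂ i o₂ = 0) {A : Matrix μ ι (ZMod 2)[X]}
    {B : Matrix μ κ (ZMod 2)[X]} (hA : D * A = A * D₁) (hB : D * B = B * D₂)
    {t w : μ → (ZMod 2)[X]} (ht : IsTowerGen D t) (hw : w ᵥ* D = 0) (hwA : (w ᵥ* A) o₁ = 1)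
    (htB : (t ᵥ* B) o₂ = 1) : (t ᵥ* A) o₁ = 1 ∧ (w ᵥ* B) o₂ = 1 := by
  obtain ⟨r, k, v, hv⟩ := ht.2.2 w hw
  have key : ∀ {ν : Type} [Fintype ν] [DecidableEq ν] {D' : Matrix ν ν (ZMod 2)[X]} {o : ν}
      {F : Matrix μ ν (ZMod 2)[X]}, (∀ i, D' i o = 0) → D * F = F * D' →
      (w ᵥ* F) o = r * (t ᵥ* F) o := by
    intro ν _ _ D' o F h0 hF
    have h := congrArg (fun y => (y ᵥ* F) o) hv
    simp only [Matrix.vecMul_vecMul, hF] at h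
    rw [← Matrix.vecMul_vecMul, vecMul_apply_eq_zero h0, Matrix.smul_vecMul, Matrix.sub_vecMul,
      Matrix.smul_vecMul] at h
    simp only [Pi.smul_apply, Pi.sub_apply, smul_eq_mul] at h
    exact sub_eq_zero.1 ((mul_eq_zero.1 h).resolve_left (pow_ne_zero _ X_ne_zero))
  have hkA := key h₁ hA
  rw [hwA] at hkA
  have hr : r = 1 := eq_one_of_mul_eq_one (p := (t ᵥ* A) o₁) (by rw [mul_comm, ← hkA])
  refine ⟨eq_one_of_mul_eq_one hkA.symm, ?_⟩
  rw [key h₂ hB, hr, htB, one_mul]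

end

/-! ### Linear maps and matrices -/

/-- The differential of a pre-complex as a matrix acting on row vectors. -/
noncomputable def dmat (C : PreCx) : Matrix (Fin C.n) (Fin C.n) RUV := Matrix.of C.dm

/-- The linear map given by a matrix acting on row vectors. -/
noncomputable def lin {a b : ℕ} (M : Matrix (Fin a) (Fin b) RUV) :
    (Fin a →₀ RUV) →ₗ[RUV] (Fin b →₀ RUV) :=
  Finsupp.linearCombination RUV fun i => ∑ j, Finsupp.single j (M i j)

/-- The matrix of a linear map. -/
noncomputable def matOf {a b : ℕ} (f : (Fin a →₀ RUV) →ₗ[RUV] (Fin b →₀ RUV)) : Matrix (Fin a) (Fin b) RUV :=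
  Matrix.of fun i j => f (Finsupp.single i 1) j

theorem lin_apply {a b : ℕ} (M : Matrix (Fin a) (Fin b) RUV) (x : Fin a →₀ RUV) :
    ⇑(lin M x) = ⇑x ᵥ* M := by
  ext1 j
  rw [lin, Finsupp.linearCombination_apply, Finsupp.sum_fintype _ _ (by simp)]
  simp [Finsupp.finsetSum_apply, Finsupp.single_apply, Matrix.vecMul, dotProduct]

theorem coe_apply {a b : ℕ} (f : (Fin a →₀ RUV) →ₗ[RUV] (Fin b →₀ RUV)) (x : Fin a →₀ RUV) :
    ⇑(f x) = ⇑x ᵥ* matOf f := by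
  ext1 j
  conv_lhs => rw [← Finsupp.univ_sum_single x, map_sum, Finsupp.finsetSum_apply]
  refine Finset.sum_congr rfl fun i _ => ?_
  rw [← mul_one (x i), ← smul_eq_mul, ← Finsupp.smul_single, map_smul, Finsupp.smul_apply]
  simp [matOf]

theorem dmap_apply (C : PreCx) (x : Msub C) : ⇑(dmap C x) = ⇑x ᵥ* dmat C :=
  lin_apply (dmat C) x

theorem dmat_mul_matOf {C₁ C₂ : PreCx} {f : Msub C₁ →ₗ[RUV] Msub C₂}
    (hf : ∀ x, f (dmap C₁ x) = dmap C₂ (f x)) : dmat C₁ * matOf f = matOf f * dmat C₂ := by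
  ext1 i j
  have h := congrArg (fun y => (y : Fin C₂.n →₀ RUV) j) (hf (Finsupp.single i 1))
  simp only [coe_apply f, dmap_apply, Finsupp.single_eq_pi_single,
    Matrix.single_one_vecMul] at h
  exact h

/-- The reduction modulo `U` of a chain. -/
noncomputable def chainV {a : ℕ} (x : Fin a →₀ RUV) : Fin a → (ZMod 2)[X] := fun i => projV (x i)

/-- The reduction modulo `U` of the differential. -/
noncomputable def dmatV (C : PreCx) : Matrix (Fin C.n) (Fin C.n) (ZMod 2)[X] := (dmat C).map projV

theorem chainV_apply {a b : ℕ} (f : (Fin a →₀ RUV) →ₗ[RUV] (Fin b →₀ RUV)) (x : Fin a →₀ RUV) :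
    chainV (f x) = chainV x ᵥ* (matOf f).map projV := by
  ext1 j
  rw [chainV, coe_apply, RingHom.map_vecMul]
  rfl

theorem chainV_dmap (C : PreCx) (x : Msub C) : chainV (dmap C x) = chainV x ᵥ* dmatV C := by
  ext1 j
  rw [chainV, dmap_apply, RingHom.map_vecMul]
  rfl

theorem exists_chainV_eq {a : ℕ} (y : Fin a → (ZMod 2)[X]) : ∃ x : Fin a →₀ RUV, chainV x = y :=
  ⟨Finsupp.equivFunOnFinite.symm fun i => inclV (y i), funext fun i => by
    simp [chainV, projV_inclV]⟩

theorem mem_uSub_iff {C : PreCx} {x : Msub C} : x ∈ uSub C ↔ chainV x = 0 := by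
  constructor
  · rintro ⟨y, rfl⟩
    ext1 i
    simp [chainV]
  · intro h
    choose y hy using fun i => exists_eq_Uv_mul (congrFun h i)
    refine ⟨Finsupp.equivFunOnFinite.symm y, ?_⟩
    ext i
    simp [hy i]

theorem mem_bdryU_iff {C : PreCx} {x : Msub C} :
    x ∈ bdryU C ↔ ∃ w, chainV x = w ᵥ* dmatV C := by
  constructor
  · intro h
    obtain ⟨y, hy, z, ⟨w, rfl⟩, rfl⟩ := Submodule.mem_sup.1 h
    refine ⟨chainV w, ?_⟩
    rw [← chainV_dmap]
    have hy := mem_uSub_iff.1 hy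
    ext1 i
    have := congrFun hy i
    simp only [chainV, Pi.zero_apply] at this
    simp [chainV, this]
  · rintro ⟨w, hw⟩
    obtain ⟨w, rfl⟩ := exists_chainV_eq w
    refine Submodule.mem_sup.2 ⟨x - dmap C w, ?_, dmap C w, ⟨w, rfl⟩, sub_add_cancel _ _⟩
    rw [mem_uSub_iff]
    ext1 i
    have := congrFun hw i
    rw [← chainV_dmap] at this
    simp only [chainV] at this
    simp [chainV, this]

theorem isVTowerGen_iff {C : PreCx} {x : Msub C} :
    IsVTowerGen C x ↔ IsTowerGen (dmatV C) (chainV x) := by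
  have hsmul : ∀ (r : RUV) (y : Msub C), chainV (r • y) = projV r • chainV y := by
    intro r y
    ext1 i
    simp [chainV]
  have hsub : ∀ y z : Msub C, chainV (y - z) = chainV y - chainV z := by
    intro y z
    ext1 i
    simp [chainV]
  simp only [IsVTowerGen, IsTowerGen, mem_uSub_iff, mem_bdryU_iff, chainV_dmap, hsmul, hsub,
    map_pow, projV_Vv]
  refine and_congr_right fun _ => and_congr_right fun _ => ⟨fun h z hz => ?_, fun h z hz => ?_⟩
  · obtain ⟨z, rfl⟩ := exists_chainV_eq z
    obtain ⟨r, k, w, hw⟩ := h z hz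
    exact ⟨projV r, k, w, hw⟩
  · obtain ⟨r, k, w, hw⟩ := h _ hz
    exact ⟨inclV r, k, w, by rw [projV_inclV, hw]⟩

theorem IsLocalMap.matrix {C₁ C₂ : PreCx} {f : Msub C₁ →ₗ[RUV] Msub C₂} (hf : IsLocalMap C₁ C₂ f) :
    dmatV C₁ * (matOf f).map projV = (matOf f).map projV * dmatV C₂ := by
  rw [dmatV, dmatV, ← Matrix.map_mul, ← Matrix.map_mul, dmat_mul_matOf hf.chain]

theorem IsLocalMap.isTowerGen {C₁ C₂ : PreCx} {f : Msub C₁ →ₗ[RUV] Msub C₂}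
    (hf : IsLocalMap C₁ C₂ f) {x : Fin C₁.n → (ZMod 2)[X]} (hx : IsTowerGen (dmatV C₁) x) :
    IsTowerGen (dmatV C₂) (x ᵥ* (matOf f).map projV) := by
  obtain ⟨x, rfl⟩ := exists_chainV_eq x
  rw [← chainV_apply]
  exact isVTowerGen_iff.1 (hf.towers x (isVTowerGen_iff.2 hx))

theorem isLocalMap_lin {C₁ C₂ : PreCx} {o₁ : Fin C₁.n} {o₂ : Fin C₂.n}
    (h₁ : IsPointed (dmatV C₁) o₁) (h₂ : IsPointed (dmatV C₂) o₂)
    {M : Matrix (Fin C₁.n) (Fin C₂.n) RUV} (hM : dmat C₁ * M = M * dmat C₂) {s : ℤ}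
    (hs : HomogMatrix C₁.gr C₂.gr (0, s) M) (ho : projV (M o₁ o₂) = 1) :
    IsLocalMap C₁ C₂ (lin M) where
  chain x := by
    apply DFunLike.coe_injective
    change ⇑(lin M (dmap C₁ x)) = ⇑(dmap C₂ (lin M x))
    rw [lin_apply, dmap_apply, dmap_apply, lin_apply, Matrix.vecMul_vecMul, hM,
      Matrix.vecMul_vecMul]
  graded := ⟨s, fun i j => by
    rw [lin_apply, Finsupp.single_eq_pi_single, Matrix.single_one_vecMul]
    exact hs i j⟩
  towers x hx := by
    rw [isVTowerGen_iff, h₁.isTowerGen_iff] at hx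
    have hMV : dmatV C₁ * M.map projV = M.map projV * dmatV C₂ := by
      rw [dmatV, dmatV, ← Matrix.map_mul, ← Matrix.map_mul, hM]
    have hx' : chainV (lin M x) = chainV x ᵥ* M.map projV := by
      ext1 j
      rw [chainV, lin_apply, RingHom.map_vecMul]
      rfl
    rw [isVTowerGen_iff, h₂.isTowerGen_iff, hx']
    refine ⟨?_, ?_⟩
    · rw [Matrix.vecMul_vecMul, ← hMV, ← Matrix.vecMul_vecMul, hx.1, Matrix.zero_vecMul]
    · rw [h₁.vecMul_apply h₂.col hMV hx.1, hx.2, one_mul, Matrix.map_apply, ho]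

/-- Chain maps between pointed complexes which are the identity on the towers induce local maps
between the shifted complexes. -/
theorem localLE_of_shiftRelated {a b : ℕ} {σ : ℕ → ℕ} (hσ : StrictMono σ)
    {d₁ d₁' : Matrix (Fin a) (Fin a) RUV} {d₂ d₂' : Matrix (Fin b) (Fin b) RUV}
    (h₁ : ShiftRelatedUV σ d₁ d₁') (h₂ : ShiftRelatedUV σ d₂ d₂') {g₁ : Fin a → ℤ × ℤ}
    {g₂ : Fin b → ℤ × ℤ} (hg₁ : HomogMatrix g₁ g₁ (-1, -1) d₁')
    (hg₂ : HomogMatrix g₂ g₂ (-1, -1) d₂') {o₁ : Fin a} {o₂ : Fin b}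
    (p₁ : IsPointed (d₁'.map projV) o₁) (p₂ : IsPointed (d₂'.map projV) o₂)
    (ho₁ : (g₁ o₁).1 = 0) (ho₂ : (g₂ o₂).1 = 0) {M : Matrix (Fin a) (Fin b) RUV}
    (hM : d₁ * M = M * d₂) (ho : projV (M o₁ o₂) = 1) :
    LocalLE ⟨a, g₁, d₁'⟩ ⟨b, g₂, d₂'⟩ := by
  obtain ⟨M', hM', hs, hc⟩ :=
    h₁.exists_lift hσ h₂ hg₁ hg₂ (0, (g₂ o₂).2 - (g₁ o₁).2) hM
  have hc := hc o₁ o₂ (by ext <;> simp [ho₁, ho₂])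
  refine ⟨lin M', isLocalMap_lin (C₁ := ⟨a, g₁, d₁'⟩) (C₂ := ⟨b, g₂, d₂'⟩) p₁ p₂ hM' hs ?_⟩
  rw [ho, coeff_one_zero] at hc
  rcases hs o₁ o₂ with h | ⟨k, h, h', -⟩ | ⟨k, h, -, h'⟩
  · rw [h, map_zero, coeff_zero] at hc
    exact absurd hc zero_ne_one
  · obtain rfl : k = 0 := by
      dsimp only at h'
      omega
    rw [h, pow_zero, map_one]
  · obtain rfl : k = 0 := by
      dsimp only at h'
      omega
    rw [h, pow_zero, map_one]

/-! ### Standard complexes -/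

/-- The differential of the standard complex with parameters `b 0, …, b (n - 1)`. -/
noncomputable def stdMat (n : ℕ) (b : ℕ → ℤ) : Matrix (Fin (n + 1)) (Fin (n + 1)) RUV := fun i j =>
  if (j : ℕ) = (i : ℕ) + 1 ∧ b i < 0 then (if (i : ℕ) % 2 = 0 then Uv else Vv) ^ (b i).natAbs
  else if (i : ℕ) = (j : ℕ) + 1 ∧ 0 < b j then
    (if (j : ℕ) % 2 = 0 then Uv else Vv) ^ (b j).natAbs
  else 0

/-- The bigrading of the standard complex with parameters `b 0, …, b (n - 1)`. -/
noncomputable def stdGrading (n : ℕ) (b : ℕ → ℤ) (i : Fin (n + 1)) : ℤ × ℤ :=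
  ((∑ k ∈ Finset.range i, stepShift k (b k)).1,
    (∑ k ∈ Finset.range i, stepShift k (b k)).2 - (∑ k ∈ Finset.range n, stepShift k (b k)).2)

/-- The standard complex with parameters `b 0, …, b (n - 1)`. -/
noncomputable def stdN (n : ℕ) (b : ℕ → ℤ) : PreCx := ⟨n + 1, stdGrading n b, stdMat n b⟩

theorem stdCx_eq_stdN {L : List ℤ} {n : ℕ} {b : ℕ → ℤ} (hn : L.length = n)
    (hb : (fun i => L.getD i 0) = b) : StdCx L = stdN n b := by
  subst hn hb
  rfl

/-- The shift of a single parameter. -/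
def shiftParam (m : ℕ) (a : ℤ) : ℤ :=
  if (m : ℤ) ≤ a then a + 1 else if a ≤ -(m : ℤ) then a - 1 else a

/-- The effect of the shift on arrow lengths. -/
def shiftLen (m k : ℕ) : ℕ := if k < m then k else k + 1

theorem shiftLen_strictMono (m : ℕ) : StrictMono (shiftLen m) := by
  intro a b h
  unfold shiftLen
  split_ifs <;> omega

theorem natAbs_shiftParam (m : ℕ) (a : ℤ) : (shiftParam m a).natAbs = shiftLen m a.natAbs := by
  unfold shiftParam shiftLen
  split_ifs <;> omega

theorem shiftParam_neg_iff {m : ℕ} (hm : 1 ≤ m) (a : ℤ) : shiftParam m a < 0 ↔ a < 0 := by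
  unfold shiftParam
  split_ifs <;> omega

theorem shiftParam_pos_iff {m : ℕ} (hm : 1 ≤ m) (a : ℤ) : 0 < shiftParam m a ↔ 0 < a := by
  unfold shiftParam
  split_ifs <;> omega

theorem stdCx_shSeq {m : ℕ} (hm : 1 ≤ m) (L : List ℤ) :
    StdCx (shSeq m L) = stdN L.length fun i => shiftParam m (L.getD i 0) := by
  refine stdCx_eq_stdN (by simp [shSeq]) (funext fun i => ?_)
  have h0 : shiftParam m 0 = 0 := by
    unfold shiftParam
    split_ifs <;> omega
  change (L.map (shiftParam m)).getD i 0 = _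
  simp only [List.getD_eq_getElem?_getD, List.getElem?_map]
  cases L[i]? <;> simp [h0]

/-- The matching given by the arrows of parity `c` of a standard complex. -/
def stdMatching (n : ℕ) (b : ℕ → ℤ) (N c : ℕ) (hc : c < 2)
    (hb : ∀ k < n, b k ≠ 0 ∧ (b k).natAbs < N) :
    Matching (Fin (n + 1)) N where
  arrow i j := ((j : ℕ) = i + 1 ∧ (i : ℕ) % 2 = c ∧ b i < 0) ∨
    ((i : ℕ) = j + 1 ∧ (j : ℕ) % 2 = c ∧ 0 < b j)
  len i := if (i : ℕ) % 2 = c then (if (i : ℕ) < n then (b i).natAbs else N)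
    else if 1 ≤ (i : ℕ) then (b (i - 1)).natAbs else N
  arrow_right_unique := by
    rintro i j k (⟨h1, h2, h3⟩ | ⟨h1, h2, h3⟩) (⟨h4, h5, h6⟩ | ⟨h4, h5, h6⟩) <;> ext <;> omega
  arrow_left_unique := by
    rintro i j k (⟨h1, h2, h3⟩ | ⟨h1, h2, h3⟩) (⟨h4, h5, h6⟩ | ⟨h4, h5, h6⟩) <;> ext <;> omega
  not_arrow_arrow := by
    rintro i j k (⟨h1, h2, h3⟩ | ⟨h1, h2, h3⟩) (⟨h4, h5, h6⟩ | ⟨h4, h5, h6⟩)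
    · omega
    · have : (k : ℕ) = i := by omega
      rw [this] at h6
      omega
    · rw [h4] at *
      have : (i : ℕ) = k := by omega
      omega
    · omega
  len_eq := by
    rintro i j (⟨h1, h2, h3⟩ | ⟨h1, h2, h3⟩)
    · have hi : (i : ℕ) < n := by omega
      have hj : (j : ℕ) % 2 ≠ c := by omega
      have hj' : (j : ℕ) - 1 = i := by omega
      rw [if_pos h2, if_pos hi, if_neg hj, if_pos (by omega), hj']
    · have hi : (j : ℕ) < n := by omega
      have hj : (i : ℕ) % 2 ≠ c := by omega
      have hj' : (i : ℕ) - 1 = j := by omega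
      rw [if_pos h2, if_pos hi, if_neg hj, if_pos (by omega), hj']
  len_lt := by
    rintro i j (⟨h1, h2, h3⟩ | ⟨h1, h2, h3⟩)
    · have hi : (i : ℕ) < n := by omega
      simpa [h2, hi] using (hb i hi).2
    · have hi : (j : ℕ) < n := by omega
      have hj : (i : ℕ) % 2 ≠ c := by omega
      have hj' : (i : ℕ) - 1 = j := by omega
      rw [if_neg hj, if_pos (by omega), hj']
      exact (hb j hi).2
  len_unmatched := by
    intro i h h'
    split_ifs with h1 h2 h3
    · have h4 := h ⟨i + 1, by omega⟩
      have h5 := h' ⟨i + 1, by omega⟩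
      have h6 := (hb i h2).1
      dsimp only at h4 h5
      omega
    · rfl
    · have h4 := h ⟨i - 1, by omega⟩
      have h5 := h' ⟨i - 1, by omega⟩
      have h6 := (hb (i - 1) (by omega)).1
      dsimp only at h4 h5
      omega
    · rfl

theorem stdMat_map {n : ℕ} {b b' : ℕ → ℤ} {N c : ℕ} (hc : c < 2)
    (hb : ∀ k < n, b k ≠ 0 ∧ (b k).natAbs < N) {σ : ℕ → ℕ}
    (hneg : ∀ k, b' k < 0 ↔ b k < 0) (hpos : ∀ k, 0 < b' k ↔ 0 < b k)
    (habs : ∀ k, (b' k).natAbs = σ (b k).natAbs) {φ : RUV →+* (ZMod 2)[X]}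
    (hφ : ∀ k e, e ≠ 0 → φ ((if k % 2 = 0 then Uv else Vv) ^ e) = if k % 2 = c then X ^ e else 0) :
    (stdMat n b').map φ = (stdMatching n b N c hc hb).diff σ := by
  ext1 i j
  simp only [Matrix.map_apply, stdMat, Matching.diff]
  by_cases h1 : (j : ℕ) = i + 1 ∧ b i < 0
  · obtain ⟨h1, h2⟩ := h1
    have h2' := (hneg i).2 h2
    have hi : (i : ℕ) < n := by omega
    rw [if_pos ⟨h1, h2'⟩, hφ _ _ (by omega), habs]
    by_cases h3 : (i : ℕ) % 2 = c
    · have hlen : (stdMatching n b N c hc hb).len i = (b i).natAbs := by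
        dsimp only [stdMatching]
        rw [if_pos h3, if_pos hi]
      have harr : (stdMatching n b N c hc hb).arrow i j := Or.inl ⟨h1, h3, h2⟩
      rw [if_pos h3, if_pos harr, hlen]
    · rw [if_neg h3, if_neg]
      rintro (⟨-, h, -⟩ | ⟨h, -, -⟩) <;> omega
  rw [if_neg (by rwa [hneg])]
  by_cases h2 : (i : ℕ) = j + 1 ∧ 0 < b j
  · obtain ⟨h2, h3⟩ := h2
    have h3' := (hpos j).2 h3
    have hj : (i : ℕ) - 1 = j := by omega
    rw [if_pos ⟨h2, h3'⟩, hφ _ _ (by omega), habs]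
    by_cases h4 : (j : ℕ) % 2 = c
    · have hlen : (stdMatching n b N c hc hb).len i = (b j).natAbs := by
        dsimp only [stdMatching]
        rw [if_neg (by omega), if_pos (by omega), hj]
      have harr : (stdMatching n b N c hc hb).arrow i j := Or.inr ⟨h2, h4, h3⟩
      rw [if_pos h4, if_pos harr, hlen]
    · rw [if_neg h4, if_neg]
      rintro (⟨h, -, -⟩ | ⟨-, h, -⟩) <;> omega
  rw [if_neg (by rwa [hpos]), map_zero, if_neg]
  rintro (⟨h, -, h'⟩ | ⟨h, -, h'⟩)
  exacts [h1 ⟨h, h'⟩, h2 ⟨h, h'⟩]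

theorem projU_pow (k e : ℕ) (he : e ≠ 0) :
    projU ((if k % 2 = 0 then Uv else Vv) ^ e) = if k % 2 = 0 then X ^ e else 0 := by
  split_ifs <;> simp [he]

theorem projV_pow (k e : ℕ) (he : e ≠ 0) :
    projV ((if k % 2 = 0 then Uv else Vv) ^ e) = if k % 2 = 1 then X ^ e else 0 := by
  rcases Nat.mod_two_eq_zero_or_one k with h | h <;> simp [he, h]

theorem isHomog_pow {k e : ℕ} {p : ℤ × ℤ}
    (hp : p = if k % 2 = 0 then (-(2 * (e : ℤ)), 0) else (0, -(2 * (e : ℤ)))) :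
    IsHomog ((if k % 2 = 0 then Uv else Vv) ^ e) p.1 p.2 := by
  subst hp
  split_ifs
  · exact Or.inr (Or.inl ⟨e, rfl, rfl, rfl⟩)
  · exact Or.inr (Or.inr ⟨e, rfl, rfl, rfl⟩)

theorem stdMat_homog (n : ℕ) (b : ℕ → ℤ) :
    HomogMatrix (stdGrading n b) (stdGrading n b) (-1, -1) (stdMat n b) := by
  intro i j
  unfold stdMat
  by_cases h1 : (j : ℕ) = i + 1 ∧ b i < 0
  · rw [if_pos h1]
    refine isHomog_pow (p := (_, _)) ?_
    simp only [stdGrading, h1.1, Finset.sum_range_succ, stepShift, if_pos h1.2]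
    split_ifs <;> ext <;> simp <;> ring
  rw [if_neg h1]
  by_cases h2 : (i : ℕ) = j + 1 ∧ 0 < b j
  · rw [if_pos h2]
    refine isHomog_pow (p := (_, _)) ?_
    simp only [stdGrading, h2.1, Finset.sum_range_succ, stepShift, if_neg h2.2.not_gt]
    split_ifs <;> ext <;> simp <;> ring
  · rw [if_neg h2]
    exact Or.inl rfl

theorem exists_bound (n : ℕ) (b : ℕ → ℤ) : ∃ N, ∀ k < n, (b k).natAbs < N :=
  ⟨∑ k ∈ Finset.range n, (b k).natAbs + 1, fun _ hk =>
    Nat.lt_succ_of_le (Finset.single_le_sum (f := fun k => (b k).natAbs)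
      (fun _ _ => Nat.zero_le _) (Finset.mem_range.2 hk))⟩

theorem stdMat_isPointed {n : ℕ} (hn : Even n) {b : ℕ → ℤ} (hb : ∀ k < n, b k ≠ 0) :
    IsPointed ((stdMat n b).map projV) 0 := by
  obtain ⟨N, hN⟩ := exists_bound n b
  rw [stdMat_map (c := 1) one_lt_two (fun k hk => ⟨hb k hk, hN k hk⟩) (σ := id) (fun _ => Iff.rfl) (fun _ => Iff.rfl)
    (fun _ => rfl) projV_pow]
  refine Matching.isPointed _ _ strictMono_id ?_ ?_ ?_
  · intro i hi
    have hi : (i : ℕ) ≠ 0 := fun h => hi (Fin.ext h)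
    obtain ⟨r, rfl⟩ := hn
    rcases Nat.mod_two_eq_zero_or_one i with h | h
    · have h0 := hb (i - 1) (by omega)
      rcases lt_or_gt_of_ne h0 with h1 | h1
      · exact Or.inr ⟨⟨i - 1, by omega⟩, Or.inl ⟨by simp only; omega, by simp only; omega, h1⟩⟩
      · exact Or.inl ⟨⟨i - 1, by omega⟩, Or.inr ⟨by simp only; omega, by simp only; omega, h1⟩⟩
    · have h0 := hb i (by omega)
      rcases lt_or_gt_of_ne h0 with h1 | h1
      · exact Or.inl ⟨⟨i + 1, by omega⟩, Or.inl ⟨rfl, h, h1⟩⟩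
      · exact Or.inr ⟨⟨i + 1, by omega⟩, Or.inr ⟨rfl, h, h1⟩⟩
  · rintro j (⟨h1, h2, h3⟩ | ⟨h1, h2, h3⟩) <;> simp at h1 h2
  · rintro j (⟨h1, h2, h3⟩ | ⟨h1, h2, h3⟩) <;> simp at h1 h2

/-! ### Tensor products of complexes and the main theorem -/

theorem IsStdSeq.getD_ne_zero {L : List ℤ} (hL : IsStdSeq L) {k : ℕ} (hk : k < L.length) :
    L.getD k 0 ≠ 0 := by
  rw [List.getD_eq_getElem _ _ hk]
  exact hL.1 _ (List.getElem_mem hk)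

theorem shiftParam_ne_zero {m : ℕ} (hm : 1 ≤ m) {a : ℤ} (ha : a ≠ 0) : shiftParam m a ≠ 0 := by
  have h1 := shiftParam_neg_iff hm a
  have h2 := shiftParam_pos_iff hm a
  omega

theorem exists_matchings {m n N : ℕ} (hm : 1 ≤ m) {b : ℕ → ℤ}
    (hb : ∀ k < n, b k ≠ 0 ∧ (b k).natAbs < N) :
    ∃ A B : Matching (Fin (n + 1)) N, (stdMat n b).map projU = A.diff id ∧
      (stdMat n fun k => shiftParam m (b k)).map projU = A.diff (shiftLen m) ∧
      (stdMat n b).map projV = B.diff id ∧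
      (stdMat n fun k => shiftParam m (b k)).map projV = B.diff (shiftLen m) :=
  ⟨stdMatching n b N 0 two_pos hb, stdMatching n b N 1 one_lt_two hb,
    stdMat_map two_pos hb (fun _ => Iff.rfl) (fun _ => Iff.rfl) (fun _ => rfl) projU_pow,
    stdMat_map two_pos hb (fun _ => shiftParam_neg_iff hm _) (fun _ => shiftParam_pos_iff hm _)
      (fun _ => natAbs_shiftParam m _) projU_pow,
    stdMat_map one_lt_two hb (fun _ => Iff.rfl) (fun _ => Iff.rfl) (fun _ => rfl) projV_pow,
    stdMat_map one_lt_two hb (fun _ => shiftParam_neg_iff hm _) (fun _ => shiftParam_pos_iff hm _)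
      (fun _ => natAbs_shiftParam m _) projV_pow⟩

theorem stdMat_shiftRelatedUV {m n : ℕ} (hm : 1 ≤ m) {b : ℕ → ℤ} (hb : ∀ k < n, b k ≠ 0) :
    ShiftRelatedUV (shiftLen m) (stdMat n b) (stdMat n fun k => shiftParam m (b k)) := by
  obtain ⟨N, hN⟩ := exists_bound n b
  obtain ⟨A, B, h₁, h₂, h₃, h₄⟩ := exists_matchings hm fun k hk => ⟨hb k hk, hN k hk⟩
  rw [ShiftRelatedUV, h₁, h₂, h₃, h₄]
  exact ⟨A.shiftRelated _, B.shiftRelated _⟩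

/-- The differential of the tensor product, indexed as in `tensorCx`. -/
noncomputable def tensorMat {a b : ℕ} (d₁ : Matrix (Fin a) (Fin a) RUV) (d₂ : Matrix (Fin b) (Fin b) RUV) :
    Matrix (Fin (a * b)) (Fin (a * b)) RUV :=
  (tensorDiff d₁ d₂).submatrix finProdFinEquiv.symm finProdFinEquiv.symm

/-- The bigrading of the tensor product, indexed as in `tensorCx`. -/
def tensorGrading {a b : ℕ} (g₁ : Fin a → ℤ × ℤ) (g₂ : Fin b → ℤ × ℤ) (p : Fin (a * b)) : ℤ × ℤ :=
  g₁ (finProdFinEquiv.symm p).1 + g₂ (finProdFinEquiv.symm p).2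

theorem tensorMat_apply {a b : ℕ} (d₁ : Matrix (Fin a) (Fin a) RUV)
    (d₂ : Matrix (Fin b) (Fin b) RUV) (p q : Fin (a * b)) :
    tensorMat d₁ d₂ p q =
      (if (finProdFinEquiv.symm p).2 = (finProdFinEquiv.symm q).2 then
        d₁ (finProdFinEquiv.symm p).1 (finProdFinEquiv.symm q).1 else 0) +
      (if (finProdFinEquiv.symm p).1 = (finProdFinEquiv.symm q).1 then
        d₂ (finProdFinEquiv.symm p).2 (finProdFinEquiv.symm q).2 else 0) := by
  simp [tensorMat, tensorDiff, Matrix.one_apply]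

theorem tensorCx_mk {a b : ℕ} (g₁ : Fin a → ℤ × ℤ) (g₂ : Fin b → ℤ × ℤ)
    (d₁ : Matrix (Fin a) (Fin a) RUV) (d₂ : Matrix (Fin b) (Fin b) RUV) :
    tensorCx ⟨a, g₁, d₁⟩ ⟨b, g₂, d₂⟩ = ⟨a * b, tensorGrading g₁ g₂, tensorMat d₁ d₂⟩ := by
  unfold tensorCx
  congr 1
  funext p q
  exact (tensorMat_apply d₁ d₂ p q).symm

theorem dmat_tensorCx (C₁ C₂ : PreCx) : dmat (tensorCx C₁ C₂) =
    (tensorMat (dmat C₁) (dmat C₂) :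
      Matrix (Fin (tensorCx C₁ C₂).n) (Fin (tensorCx C₁ C₂).n) RUV) := by
  ext1 p q
  exact (tensorMat_apply (dmat C₁) (dmat C₂) p q).symm

theorem tensorMat_map {a b : ℕ} (φ : RUV →+* (ZMod 2)[X]) (d₁ : Matrix (Fin a) (Fin a) RUV)
    (d₂ : Matrix (Fin b) (Fin b) RUV) :
    (tensorMat d₁ d₂).map φ = (tensorDiff (d₁.map φ) (d₂.map φ)).submatrix
      finProdFinEquiv.symm finProdFinEquiv.symm := by
  rw [← map_tensorDiff]
  rfl

theorem tensorMat_isPointed {a b : ℕ} {d₁ : Matrix (Fin a) (Fin a) RUV}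
    {d₂ : Matrix (Fin b) (Fin b) RUV} {o₁ : Fin a} {o₂ : Fin b} (h₁ : IsPointed (d₁.map projV) o₁)
    (h₂ : IsPointed (d₂.map projV) o₂) :
    IsPointed ((tensorMat d₁ d₂).map projV) (finProdFinEquiv (o₁, o₂)) := by
  rw [tensorMat_map]
  exact (h₁.tensorDiff h₂).submatrix finProdFinEquiv.symm

theorem tensorMat_shiftRelatedUV {m n n' : ℕ} (hm : 1 ≤ m) {b b' : ℕ → ℤ} (hb : ∀ k < n, b k ≠ 0)
    (hb' : ∀ k < n', b' k ≠ 0) :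
    ShiftRelatedUV (shiftLen m) (tensorMat (stdMat n b) (stdMat n' b'))
      (tensorMat (stdMat n fun k => shiftParam m (b k))
        (stdMat n' fun k => shiftParam m (b' k))) := by
  obtain ⟨N, hN⟩ := exists_bound n b
  obtain ⟨N', hN'⟩ := exists_bound n' b'
  obtain ⟨A, B, h₁, h₂, h₃, h₄⟩ :=
    exists_matchings (N := N + N') hm fun k hk => ⟨hb k hk, (hN k hk).trans_le (Nat.le_add_right _ _)⟩
  obtain ⟨A', B', h₁', h₂', h₃', h₄'⟩ :=
    exists_matchings (N := N + N') hm fun k hk =>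
      ⟨hb' k hk, (hN' k hk).trans_le (Nat.le_add_left _ _)⟩
  simp only [ShiftRelatedUV, tensorMat_map]
  rw [h₁, h₂, h₃, h₄, h₁', h₂', h₃', h₄']
  exact ⟨(A.shiftRelated_tensorDiff A' (shiftLen_strictMono m)).submatrix _,
    (B.shiftRelated_tensorDiff B' (shiftLen_strictMono m)).submatrix _⟩

theorem RUV_add_self (r : RUV) : r + r = 0 := by
  apply proj_ext <;> rw [map_add, map_zero] <;> exact CharTwo.add_self_eq_zero _

theorem IsHomog.add {r s : RUV} {p q : ℤ} (hr : IsHomog r p q) (hs : IsHomog s p q) :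
    IsHomog (r + s) p q := by
  rcases hr with rfl | ⟨a, rfl, h1, h2⟩ | ⟨a, rfl, h1, h2⟩
  · rwa [zero_add]
  all_goals
    rcases hs with rfl | ⟨c, rfl, h3, h4⟩ | ⟨c, rfl, h3, h4⟩
    · rw [add_zero]
      first
        | exact Or.inr (Or.inl ⟨a, rfl, h1, h2⟩)
        | exact Or.inr (Or.inr ⟨a, rfl, h1, h2⟩)
    all_goals
      left
      first
        | obtain rfl : a = c := by omega
          exact RUV_add_self _
        | obtain rfl : a = 0 := by omega
          obtain rfl : c = 0 := by omega
          rw [pow_zero, pow_zero]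
          exact RUV_add_self _

theorem tensorMat_homog {a b : ℕ} {g₁ : Fin a → ℤ × ℤ} {g₂ : Fin b → ℤ × ℤ}
    {d₁ : Matrix (Fin a) (Fin a) RUV} {d₂ : Matrix (Fin b) (Fin b) RUV} {s : ℤ × ℤ}
    (h₁ : HomogMatrix g₁ g₁ s d₁) (h₂ : HomogMatrix g₂ g₂ s d₂) :
    HomogMatrix (tensorGrading g₁ g₂) (tensorGrading g₁ g₂) s (tensorMat d₁ d₂) := by
  intro p q
  refine ShiftHom.IsHomog.add ?_ ?_
  · rw [Matrix.kroneckerMap_apply, Matrix.one_apply]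
    split_ifs with h
    · convert h₁ (finProdFinEquiv.symm p).1 (finProdFinEquiv.symm q).1 using 1
      · rw [mul_one]
      · simp only [tensorGrading, h, Prod.fst_add]
        ring
      · simp only [tensorGrading, h, Prod.snd_add]
        ring
    · exact Or.inl (mul_zero _)
  · rw [Matrix.kroneckerMap_apply, Matrix.one_apply]
    split_ifs with h
    · convert h₂ (finProdFinEquiv.symm p).2 (finProdFinEquiv.symm q).2 using 1
      · rw [one_mul]
      · simp only [tensorGrading, h, Prod.fst_add]
        ring
      · simp only [tensorGrading, h, Prod.snd_add]
        ring
    · exact Or.inl (zero_mul _)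

/-- The tensor product of two matrices, indexed as in `tensorCx`. -/
noncomputable def kronMat {a b c d : ℕ} (F : Matrix (Fin a) (Fin c) RUV) (G : Matrix (Fin b) (Fin d) RUV) :
    Matrix (Fin (a * b)) (Fin (c * d)) RUV :=
  (F ⊗ₖ G).submatrix finProdFinEquiv.symm finProdFinEquiv.symm

theorem tensorMat_mul_kronMat {a b c d : ℕ} {F : Matrix (Fin a) (Fin c) RUV}
    {G : Matrix (Fin b) (Fin d) RUV} {d₁ : Matrix (Fin a) (Fin a) RUV}
    {d₂ : Matrix (Fin b) (Fin b) RUV} {d₁' : Matrix (Fin c) (Fin c) RUV}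
    {d₂' : Matrix (Fin d) (Fin d) RUV} (hF : d₁ * F = F * d₁') (hG : d₂ * G = G * d₂') :
    tensorMat d₁ d₂ * kronMat F G = kronMat F G * tensorMat d₁' d₂' := by
  rw [tensorMat, kronMat, tensorMat, Matrix.submatrix_mul_equiv, Matrix.submatrix_mul_equiv,
    tensorDiff_mul_kronecker hF hG]

theorem kronMat_mul_kronMat {a b c d e f : ℕ} (F : Matrix (Fin a) (Fin c) RUV)
    (G : Matrix (Fin b) (Fin d) RUV) (F' : Matrix (Fin c) (Fin e) RUV)
    (G' : Matrix (Fin d) (Fin f) RUV) :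
    kronMat F G * kronMat F' G' = kronMat (F * F') (G * G') := by
  rw [kronMat, kronMat, kronMat, Matrix.submatrix_mul_equiv, ← Matrix.mul_kronecker_mul]

theorem projV_coeff_of_isTowerGen {a : ℕ} {D : Matrix (Fin a) (Fin a) (ZMod 2)[X]} {c : ℕ} {o : Fin a}
    (hD : IsPointed D o) {i : Fin c} {M : Matrix (Fin c) (Fin a) RUV}
    (h : IsTowerGen D (Pi.single i 1 ᵥ* M.map projV)) : projV (M i o) = 1 := by
  have := (hD.isTowerGen_iff.1 h).2
  rwa [Matrix.single_one_vecMul] at this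

theorem projV_loop {C S : PreCx} {o : Fin S.n} (hS : IsPointed (dmatV S) o)
    {f : Msub C →ₗ[RUV] Msub S} {g : Msub S →ₗ[RUV] Msub C} (hf : IsLocalMap C S f)
    (hg : IsLocalMap S C g) : projV ((matOf g * matOf f) o o) = 1 := by
  have h := ShiftHom.IsLocalMap.isTowerGen hf
    (ShiftHom.IsLocalMap.isTowerGen hg hS.isTowerGen_single)
  rw [Matrix.vecMul_vecMul, ← Matrix.map_mul] at h
  exact projV_coeff_of_isTowerGen hS h

/-- Local equivalences of two complexes and of their tensor product with pointed complexes induce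
chain maps between the pointed complexes which are the identity on the towers. -/
theorem exists_chain_maps {C₁ C₂ S₁ S₂ S₃ : PreCx} {o₁ : Fin S₁.n} {o₂ : Fin S₂.n} {o₃ : Fin S₃.n}
    (p₁ : IsPointed (dmatV S₁) o₁) (p₂ : IsPointed (dmatV S₂) o₂) (p₃ : IsPointed (dmatV S₃) o₃)
    (h₁ : LocalEquiv C₁ S₁) (h₂ : LocalEquiv C₂ S₂) (h₃ : LocalEquiv (tensorCx C₁ C₂) S₃) :
    (∃ M : Matrix (Fin S₃.n) (Fin (S₁.n * S₂.n)) RUV,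
      dmat S₃ * M = M * tensorMat (dmat S₁) (dmat S₂) ∧
        projV (M o₃ (finProdFinEquiv (o₁, o₂))) = 1) ∧
    ∃ M : Matrix (Fin (S₁.n * S₂.n)) (Fin S₃.n) RUV,
      tensorMat (dmat S₁) (dmat S₂) * M = M * dmat S₃ ∧
        projV (M (finProdFinEquiv (o₁, o₂)) o₃) = 1 := by
  obtain ⟨⟨f₁, hf₁⟩, g₁, hg₁⟩ := h₁
  obtain ⟨⟨f₂, hf₂⟩, g₂, hg₂⟩ := h₂
  obtain ⟨⟨f₃, hf₃⟩, g₃, hg₃⟩ := h₃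
  let o := finProdFinEquiv (o₁, o₂)
  let A : Matrix (Fin (tensorCx C₁ C₂).n) (Fin (S₁.n * S₂.n)) RUV :=
    kronMat (matOf f₁) (matOf f₂)
  let B : Matrix (Fin (S₁.n * S₂.n)) (Fin (tensorCx C₁ C₂).n) RUV :=
    kronMat (matOf g₁) (matOf g₂)
  have hA : dmat (tensorCx C₁ C₂) * A = A * tensorMat (dmat S₁) (dmat S₂) := by
    rw [dmat_tensorCx]
    exact tensorMat_mul_kronMat (dmat_mul_matOf hf₁.chain) (dmat_mul_matOf hf₂.chain)
  have hB : tensorMat (dmat S₁) (dmat S₂) * B = B * dmat (tensorCx C₁ C₂) := by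
    rw [dmat_tensorCx]
    exact tensorMat_mul_kronMat (dmat_mul_matOf hg₁.chain) (dmat_mul_matOf hg₂.chain)
  have hF := dmat_mul_matOf hf₃.chain
  have hG := dmat_mul_matOf hg₃.chain
  have p : IsPointed ((tensorMat (dmat S₁) (dmat S₂)).map projV) o := tensorMat_isPointed p₁ p₂
  have hBA : projV ((B * A) o o) = 1 := by
    have : B * A = kronMat (matOf g₁ * matOf f₁) (matOf g₂ * matOf f₂) :=
      kronMat_mul_kronMat _ _ _ _
    rw [this]
    simp only [o, kronMat, Matrix.submatrix_apply, Equiv.symm_apply_apply,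
      Matrix.kroneckerMap_apply, map_mul]
    rw [projV_loop p₁ hf₁ hg₁, projV_loop p₂ hf₂ hg₂, one_mul]
  have key := coefficient_eq_one (D := dmatV (tensorCx C₁ C₂)) (D₂ := dmatV S₃)
    (A := A.map projV) (B := (matOf f₃).map projV) (t := Pi.single o₃ 1 ᵥ* (matOf g₃).map projV)
    (w := Pi.single o 1 ᵥ* B.map projV) p.col p₃.col
    (by rw [dmatV, ← Matrix.map_mul, ← Matrix.map_mul, hA]) (ShiftHom.IsLocalMap.matrix hf₃)
    (ShiftHom.IsLocalMap.isTowerGen hg₃ p₃.isTowerGen_single)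
    (by
      rw [Matrix.vecMul_vecMul, dmatV, ← Matrix.map_mul, ← hB, Matrix.map_mul,
        ← Matrix.vecMul_vecMul, (p.isTowerGen_iff.1 p.isTowerGen_single).1, Matrix.zero_vecMul])
    (by
      rw [Matrix.vecMul_vecMul, ← Matrix.map_mul, Matrix.single_one_vecMul]
      exact hBA)
    (by
      rw [Matrix.vecMul_vecMul, ← Matrix.map_mul, Matrix.single_one_vecMul]
      exact projV_loop p₃ hf₃ hg₃)
  rw [Matrix.vecMul_vecMul, Matrix.vecMul_vecMul, ← Matrix.map_mul, ← Matrix.map_mul,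
    Matrix.single_one_vecMul, Matrix.single_one_vecMul] at key
  refine ⟨⟨matOf g₃ * A, ?_, key.1⟩, B * matOf f₃, ?_, key.2⟩
  · rw [← Matrix.mul_assoc, hG, Matrix.mul_assoc, hA, Matrix.mul_assoc]
  · rw [← Matrix.mul_assoc, hB, Matrix.mul_assoc, hF, Matrix.mul_assoc]

theorem stdGrading_zero (n : ℕ) (b : ℕ → ℤ) : (stdGrading n b 0).1 = 0 := by
  simp [stdGrading]

theorem localLE_shSeq {m : ℕ} (hm : 1 ≤ m) {L L' : List ℤ} (hL : IsStdSeq L) (hL' : IsStdSeq L')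
    (h : LocalLE (StdCx L) (StdCx L')) : LocalLE (StdCx (shSeq m L)) (StdCx (shSeq m L')) := by
  have hb := fun k => ShiftHom.IsStdSeq.getD_ne_zero hL (k := k)
  have hb' := fun k => ShiftHom.IsStdSeq.getD_ne_zero hL' (k := k)
  obtain ⟨f, hf⟩ := h
  have hp : IsPointed (dmatV (StdCx L)) (0 : Fin (L.length + 1)) := stdMat_isPointed hL.2 hb
  have hp' : IsPointed (dmatV (StdCx L')) (0 : Fin (L'.length + 1)) := stdMat_isPointed hL'.2 hb'
  rw [stdCx_shSeq hm, stdCx_shSeq hm]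
  exact localLE_of_shiftRelated (shiftLen_strictMono m) (stdMat_shiftRelatedUV hm hb)
    (stdMat_shiftRelatedUV hm hb') (stdMat_homog _ _) (stdMat_homog _ _)
    (stdMat_isPointed hL.2 fun k hk => shiftParam_ne_zero hm (hb k hk))
    (stdMat_isPointed hL'.2 fun k hk => shiftParam_ne_zero hm (hb' k hk))
    (stdGrading_zero _ _) (stdGrading_zero _ _) (dmat_mul_matOf hf.chain)
    (projV_coeff_of_isTowerGen hp' (ShiftHom.IsLocalMap.isTowerGen hf hp.isTowerGen_single))

theorem localEquiv_shSeq_tensorCx {m : ℕ} (hm : 1 ≤ m) {C₁ C₂ : PreCx} {L₁ L₂ L₃ : List ℤ}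
    (hL₁ : IsStdSeq L₁) (hL₂ : IsStdSeq L₂) (hL₃ : IsStdSeq L₃) (h₁ : LocalEquiv C₁ (StdCx L₁))
    (h₂ : LocalEquiv C₂ (StdCx L₂)) (h₃ : LocalEquiv (tensorCx C₁ C₂) (StdCx L₃)) :
    LocalEquiv (StdCx (shSeq m L₃))
      (tensorCx (StdCx (shSeq m L₁)) (StdCx (shSeq m L₂))) := by
  have hb₁ := fun k => ShiftHom.IsStdSeq.getD_ne_zero hL₁ (k := k)
  have hb₂ := fun k => ShiftHom.IsStdSeq.getD_ne_zero hL₂ (k := k)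
  have hb₃ := fun k => ShiftHom.IsStdSeq.getD_ne_zero hL₃ (k := k)
  obtain ⟨⟨M, hM, hM1⟩, M', hM', hM1'⟩ := exists_chain_maps (S₁ := StdCx L₁) (S₂ := StdCx L₂)
    (S₃ := StdCx L₃) (o₁ := (0 : Fin (L₁.length + 1))) (o₂ := (0 : Fin (L₂.length + 1)))
    (o₃ := (0 : Fin (L₃.length + 1))) (stdMat_isPointed hL₁.2 hb₁) (stdMat_isPointed hL₂.2 hb₂)
    (stdMat_isPointed hL₃.2 hb₃) h₁ h₂ h₃
  have hr₃ := stdMat_shiftRelatedUV hm hb₃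
  have hr := tensorMat_shiftRelatedUV hm hb₁ hb₂
  have q₁ := stdMat_isPointed hL₁.2 fun k hk => shiftParam_ne_zero hm (hb₁ k hk)
  have q₂ := stdMat_isPointed hL₂.2 fun k hk => shiftParam_ne_zero hm (hb₂ k hk)
  have q₃ := stdMat_isPointed hL₃.2 fun k hk => shiftParam_ne_zero hm (hb₃ k hk)
  have q := tensorMat_isPointed q₁ q₂
  have hg := fun g₁ g₂ => tensorMat_homog (stdMat_homog L₁.length g₁) (stdMat_homog L₂.length g₂)
  have h0 : ∀ g₁ g₂, (tensorGrading (stdGrading L₁.length g₁) (stdGrading L₂.length g₂)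
      (finProdFinEquiv (0, 0))).1 = 0 := by
    intro g₁ g₂
    rw [tensorGrading, Equiv.symm_apply_apply, Prod.fst_add, stdGrading_zero, stdGrading_zero,
      add_zero]
  rw [stdCx_shSeq hm, stdCx_shSeq hm, stdCx_shSeq hm, stdN, stdN, stdN, tensorCx_mk]
  exact ⟨localLE_of_shiftRelated (shiftLen_strictMono m) hr₃ hr (stdMat_homog _ _) (hg _ _) q₃ q
      (stdGrading_zero _ _) (h0 _ _) hM hM1,
    localLE_of_shiftRelated (shiftLen_strictMono m) hr hr₃ (hg _ _) (stdMat_homog _ _) q q₃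
      (h0 _ _) (stdGrading_zero _ _) hM' hM1'⟩

end ShiftHom

/-- For every `m ≥ 1` and any two knot-like complexes `C₁, C₂`, the
shifted complex `sh_m(C₁ ⊗_R C₂)` is locally equivalent to `sh_m(C₁) ⊗_R sh_m(C₂)`,
where `sh_m` is computed on standard complex representatives.  Moreover `sh_m` is well
defined on local equivalence classes; consequently it defines a group endomorphism of
the local equivalence group `KL`. -/
theorem shift_is_homomorphism (m : ℕ) (hm : 1 ≤ m) :
    (∀ C₁ C₂ : PreCx, IsKnotLike C₁ → IsKnotLike C₂ →
      ∀ L₁ L₂ L₃ : List ℤ, IsStdSeq L₁ → IsStdSeq L₂ → IsStdSeq L₃ →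
        LocalEquiv C₁ (StdCx L₁) → LocalEquiv C₂ (StdCx L₂) →
        LocalEquiv (tensorCx C₁ C₂) (StdCx L₃) →
        LocalEquiv (StdCx (shSeq m L₃))
          (tensorCx (StdCx (shSeq m L₁)) (StdCx (shSeq m L₂)))) ∧
    (∀ L L' : List ℤ, IsStdSeq L → IsStdSeq L' → LocalEquiv (StdCx L) (StdCx L') →
      LocalEquiv (StdCx (shSeq m L)) (StdCx (shSeq m L'))) := by
  exact ⟨fun _ _ _ _ _ _ _ hL₁ hL₂ hL₃ h₁ h₂ h₃ =>
      ShiftHom.localEquiv_shSeq_tensorCx hm hL₁ hL₂ hL₃ h₁ h₂ h₃,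
    fun _ _ hL hL' h =>
      ⟨ShiftHom.localLE_shSeq hm hL hL' h.1, ShiftHom.localLE_shSeq hm hL' hL h.2⟩⟩
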